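/- arXiv:1701.01981 — 2 statements merged into one kernel-verified Lean document; each statement's English description precedes it below -/
import Mathlib

section
/- (Secret hint, list version.) Suppose |𝒨_p|·|𝒨_s| > log|𝒳| + 2. For every positive integer c with c ≤ |𝒨_p| and c·|𝒨_s| > log|𝒳| + 2, there is a {0,1}-valued choice of Alice's encoder for which Bob's list ambiguity satisfies 𝒜_B^l < 1 + 2^{ρ(H_{1/(1+ρ)}(X|Y) − log(c·|𝒨_s| − log|𝒳| − 2) + 2)} and Eve's ambiguity satisfies 𝒜_E ≥ (1 + ln|𝒳|)^{−ρ} · 2^{ρ(H_{1/(1+ρ)}(X|Y) − log c)}. Conversely, for every choice of Alice's encoder, 𝒜_B^l ≥ max( 2^{ρ(H_{1/(1+ρ)}(X|Y) − log(|𝒨_p|·|𝒨_s|))}, 1 ) and 𝒜_E ≤ min( |𝒨_s|^ρ · 𝒜_B^l, 2^{ρ H_{1/(1+ρ)}(X|Y)} ). -/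
open scoped BigOperators

noncomputable section

/-- `G` is a guessing function for `X` given side information in `V`:
for every `v`, `G v` is a bijection from `X` onto `{1, …, |X|}`. -/
def IsGuess {X V : Type*} [Fintype X] (G : V → X → ℕ) : Prop :=
  ∀ v : V, Set.BijOn (G v) Set.univ (Set.Icc 1 (Fintype.card X))

/-- The conditional Rényi entropy `H_α(X|Y)` (base 2) of order `α = 1/(1+ρ)`. -/
def condRenyi {X Y : Type*} [Fintype X] [Fintype Y] (ρ : ℝ) (p : X → Y → ℝ) : ℝ :=
  ((1 / (1 + ρ)) / (1 - 1 / (1 + ρ))) *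
    Real.logb 2 (∑ y : Y, (∑ x : X, p x y ^ (1 / (1 + ρ))) ^ (1 / (1 / (1 + ρ))))

/-- Bob's guessing ambiguity `𝒜_B^g` in the secret-hint scenario: Bob sees `(Y, M_p, M_s)`. -/
def bobGuessAmbSH {𝒳 𝒴 Mp Ms : Type*} [Fintype 𝒳] [Fintype 𝒴] [Fintype Mp] [Fintype Ms]
    (ρ : ℝ) (p : 𝒳 → 𝒴 → ℝ) (e : 𝒳 → 𝒴 → Mp × Ms → ℝ) : ℝ :=
  sInf {r : ℝ | ∃ G : 𝒴 × Mp × Ms → 𝒳 → ℕ, IsGuess G ∧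
    r = ∑ x : 𝒳, ∑ y : 𝒴, ∑ m : Mp × Ms, p x y * e x y m * (G (y, m) x : ℝ) ^ ρ}

/-- Bob's list ambiguity `𝒜_B^l` in the secret-hint scenario. -/
def bobListAmbSH {𝒳 𝒴 Mp Ms : Type*} [Fintype 𝒳] [Fintype 𝒴] [Fintype Mp] [Fintype Ms]
    (ρ : ℝ) (p : 𝒳 → 𝒴 → ℝ) (e : 𝒳 → 𝒴 → Mp × Ms → ℝ) : ℝ :=
  ∑ x : 𝒳, ∑ y : 𝒴, ∑ m : Mp × Ms, p x y * e x y m *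
    (((Finset.univ.filter fun x' : 𝒳 => 0 < p x' y * e x' y m).card : ℝ)) ^ ρ

/-- Eve's ambiguity `𝒜_E` in the secret-hint scenario: Eve sees only `(Y, M_p)`. -/
def eveAmbSH {𝒳 𝒴 Mp Ms : Type*} [Fintype 𝒳] [Fintype 𝒴] [Fintype Mp] [Fintype Ms]
    (ρ : ℝ) (p : 𝒳 → 𝒴 → ℝ) (e : 𝒳 → 𝒴 → Mp × Ms → ℝ) : ℝ :=
  sInf {r : ℝ | ∃ G : 𝒴 × Mp → 𝒳 → ℕ, IsGuess G ∧
    r = ∑ x : 𝒳, ∑ y : 𝒴, ∑ mp : Mp, ∑ ms : Ms, p x y * e x y (mp, ms) *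
      (G (y, mp) x : ℝ) ^ ρ}

/-- Hölder's inequality in the form used for guessing: the convention `1 / 0 = 0` lets `g` vanish
where `q` does. -/
lemma sum_rpow_le_mul_rpow {ι : Type*} {ρ : ℝ} (hρ : 0 < ρ) (s : Finset ι) (q g : ι → ℝ)
    (hq : ∀ i ∈ s, 0 ≤ q i) (hg : ∀ i ∈ s, 0 ≤ g i) (hz : ∀ i ∈ s, g i = 0 → q i = 0) :
    (∑ i ∈ s, q i ^ (1 / (1 + ρ))) ^ (1 + ρ) ≤
      (∑ i ∈ s, q i * g i ^ ρ) * (∑ i ∈ s, 1 / g i) ^ ρ := by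
  have h1 : 0 < 1 + ρ := by linarith
  have hpq : (1 + ρ).HolderConjugate ((1 + ρ) / ρ) := by
    rw [Real.holderConjugate_iff]
    refine ⟨by linarith, by field_simp⟩
  have hA : 0 ≤ ∑ i ∈ s, q i * g i ^ ρ :=
    Finset.sum_nonneg fun i hi => mul_nonneg (hq i hi) (Real.rpow_nonneg (hg i hi) _)
  have hB : 0 ≤ ∑ i ∈ s, 1 / g i :=
    Finset.sum_nonneg fun i hi => one_div_nonneg.2 (hg i hi)
  have key := Real.inner_le_Lp_mul_Lq_of_nonneg s
    (f := fun i => (q i * g i ^ ρ) ^ (1 / (1 + ρ)))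
    (g := fun i => (1 / g i) ^ (ρ / (1 + ρ))) hpq
    (fun i hi => Real.rpow_nonneg (mul_nonneg (hq i hi) (Real.rpow_nonneg (hg i hi) _)) _)
    (fun i hi => Real.rpow_nonneg (one_div_nonneg.2 (hg i hi)) _)
  have e1 : ∑ i ∈ s, (q i * g i ^ ρ) ^ (1 / (1 + ρ)) * (1 / g i) ^ (ρ / (1 + ρ)) =
      ∑ i ∈ s, q i ^ (1 / (1 + ρ)) := by
    refine Finset.sum_congr rfl fun i hi => ?_
    rcases (hg i hi).eq_or_lt with h | h
    · rw [hz i hi h.symm, ← h]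
      simp [Real.zero_rpow (inv_pos.2 h1).ne']
    · rw [Real.mul_rpow (hq i hi) (Real.rpow_nonneg h.le _), ← Real.rpow_mul h.le, one_div (g i),
        Real.inv_rpow h.le, show ρ * (1 / (1 + ρ)) = ρ / (1 + ρ) by ring, mul_assoc,
        mul_inv_cancel₀ (Real.rpow_pos_of_pos h _).ne', mul_one]
  have e2 : ∑ i ∈ s, ((q i * g i ^ ρ) ^ (1 / (1 + ρ))) ^ (1 + ρ) = ∑ i ∈ s, q i * g i ^ ρ := by
    refine Finset.sum_congr rfl fun i hi => ?_
    rw [← Real.rpow_mul (mul_nonneg (hq i hi) (Real.rpow_nonneg (hg i hi) _)),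
      one_div_mul_cancel h1.ne', Real.rpow_one]
  have e3 : ∑ i ∈ s, ((1 / g i) ^ (ρ / (1 + ρ))) ^ ((1 + ρ) / ρ) = ∑ i ∈ s, 1 / g i := by
    refine Finset.sum_congr rfl fun i hi => ?_
    rw [← Real.rpow_mul (one_div_nonneg.2 (hg i hi)),
      show ρ / (1 + ρ) * ((1 + ρ) / ρ) = 1 by field_simp, Real.rpow_one]
  simp only [e1, e2, e3] at key
  calc (∑ i ∈ s, q i ^ (1 / (1 + ρ))) ^ (1 + ρ)
      ≤ ((∑ i ∈ s, q i * g i ^ ρ) ^ (1 / (1 + ρ)) *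
          (∑ i ∈ s, 1 / g i) ^ (1 / ((1 + ρ) / ρ))) ^ (1 + ρ) :=
        Real.rpow_le_rpow (Finset.sum_nonneg fun i hi => Real.rpow_nonneg (hq i hi) _) key h1.le
    _ = _ := by
        rw [Real.mul_rpow (Real.rpow_nonneg hA _) (Real.rpow_nonneg hB _), ← Real.rpow_mul hA,
          ← Real.rpow_mul hB, one_div_mul_cancel h1.ne', Real.rpow_one,
          show 1 / ((1 + ρ) / ρ) * (1 + ρ) = ρ by field_simp]

lemma rpow_sum_le_sum_rpow {ι : Type*} {a : ℝ} (ha : 0 < a) (ha1 : a ≤ 1) (s : Finset ι)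
    (q : ι → ℝ) (hq : ∀ i ∈ s, 0 ≤ q i) : (∑ i ∈ s, q i) ^ a ≤ ∑ i ∈ s, q i ^ a := by
  classical
  induction s using Finset.induction_on with
  | empty => simp [Real.zero_rpow ha.ne']
  | insert i s hi ih =>
    rw [Finset.sum_insert hi, Finset.sum_insert hi]
    have hs := fun j hj => hq j (Finset.mem_insert_of_mem hj)
    exact (Real.rpow_add_le_add_rpow (hq i (Finset.mem_insert_self i s)) (Finset.sum_nonneg hs)
      ha.le ha1).trans (add_le_add_right (ih hs) _)

/-- The lower bound on a `ρ`-th moment of `g` when `p` is split among the hints in `I`. -/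
lemma rpow_sum_rpow_le_moment {X M : Type*} [Fintype X] {ρ : ℝ} (hρ : 0 < ρ) (I : Finset M)
    (p : X → ℝ) (q g : X → M → ℝ) (hq : ∀ x m, 0 ≤ q x m) (hg : ∀ x m, 0 ≤ g x m)
    (hz : ∀ x m, g x m = 0 → q x m = 0) (hp : ∀ x, p x = ∑ m ∈ I, q x m) (K : ℝ)
    (hK : ∀ m ∈ I, ∑ x, 1 / g x m ≤ K) :
    (∑ x, p x ^ (1 / (1 + ρ))) ^ (1 + ρ) ≤
      (I.card * K) ^ ρ * ∑ x, ∑ m ∈ I, q x m * g x m ^ ρ := by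
  have h1 : 0 < 1 + ρ := by linarith
  have ha1 : 1 / (1 + ρ) ≤ 1 := by rw [div_le_one h1]; linarith
  have hsub : ∑ x, p x ^ (1 / (1 + ρ)) ≤
      ∑ i ∈ Finset.univ ×ˢ I, q i.1 i.2 ^ (1 / (1 + ρ)) := by
    rw [Finset.sum_product]
    refine Finset.sum_le_sum fun x _ => ?_
    rw [hp x]
    exact rpow_sum_le_sum_rpow (by positivity) ha1 I _ fun m _ => hq x m
  have hK' : ∑ i ∈ Finset.univ ×ˢ I, 1 / g i.1 i.2 ≤ I.card * K := by
    rw [Finset.sum_product_right, ← nsmul_eq_mul]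
    exact Finset.sum_le_card_nsmul _ _ _ hK
  have hp0 : ∀ x, 0 ≤ p x := fun x => by
    rw [hp x]; exact Finset.sum_nonneg fun m _ => hq x m
  calc (∑ x, p x ^ (1 / (1 + ρ))) ^ (1 + ρ)
      ≤ (∑ i ∈ Finset.univ ×ˢ I, q i.1 i.2 ^ (1 / (1 + ρ))) ^ (1 + ρ) :=
        Real.rpow_le_rpow (Finset.sum_nonneg fun x _ => Real.rpow_nonneg (hp0 x) _) hsub h1.le
    _ ≤ (∑ i ∈ Finset.univ ×ˢ I, q i.1 i.2 * g i.1 i.2 ^ ρ) *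
          (∑ i ∈ Finset.univ ×ˢ I, 1 / g i.1 i.2) ^ ρ :=
        sum_rpow_le_mul_rpow hρ (Finset.univ ×ˢ I) (fun i : X × M => q i.1 i.2)
          (fun i => g i.1 i.2) (fun i _ => hq i.1 i.2) (fun i _ => hg i.1 i.2)
          (fun i _ => hz i.1 i.2)
    _ ≤ (∑ i ∈ Finset.univ ×ˢ I, q i.1 i.2 * g i.1 i.2 ^ ρ) * (I.card * K) ^ ρ := by
        refine mul_le_mul_of_nonneg_left (Real.rpow_le_rpow ?_ hK' hρ.le) ?_
        · exact Finset.sum_nonneg fun i _ => one_div_nonneg.2 (hg _ _)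
        · exact Finset.sum_nonneg fun i _ => mul_nonneg (hq _ _) (Real.rpow_nonneg (hg _ _) _)
    _ = _ := by rw [Finset.sum_product, mul_comm]

/-- `2 ^ (ρ H(X|Y))`, written without logarithms. -/
def renyiSum {X Y : Type*} [Fintype X] [Fintype Y] (ρ : ℝ) (p : X → Y → ℝ) : ℝ :=
  ∑ y : Y, (∑ x : X, p x y ^ (1 / (1 + ρ))) ^ (1 + ρ)

lemma renyiSum_pos {X Y : Type*} [Fintype X] [Fintype Y] (ρ : ℝ) {p : X → Y → ℝ}
    (hp0 : ∀ x y, 0 ≤ p x y) (hp1 : ∑ x, ∑ y, p x y = 1) : 0 < renyiSum ρ p := by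
  obtain ⟨x, -, hx⟩ := Finset.exists_ne_zero_of_sum_ne_zero (hp1.trans_ne one_ne_zero)
  obtain ⟨y, -, hy⟩ := Finset.exists_ne_zero_of_sum_ne_zero hx
  have hy : 0 < p x y := (hp0 x y).lt_of_ne' hy
  have hn : ∀ y, 0 ≤ ∑ x, p x y ^ (1 / (1 + ρ)) := fun y =>
    Finset.sum_nonneg fun x _ => Real.rpow_nonneg (hp0 x y) _
  refine Finset.sum_pos' (fun y _ => Real.rpow_nonneg (hn y) _) ⟨y, Finset.mem_univ y, ?_⟩
  exact Real.rpow_pos_of_pos (Finset.sum_pos' (fun x _ => Real.rpow_nonneg (hp0 x y) _)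
    ⟨x, Finset.mem_univ x, Real.rpow_pos_of_pos hy _⟩) _

lemma two_rpow_mul_condRenyi_add {X Y : Type*} [Fintype X] [Fintype Y] {ρ : ℝ} (hρ : 0 < ρ)
    {p : X → Y → ℝ} (hp : 0 < renyiSum ρ p) (t : ℝ) :
    (2 : ℝ) ^ (ρ * (condRenyi ρ p + t)) = renyiSum ρ p * ((2 : ℝ) ^ t) ^ ρ := by
  have h1 : 0 < 1 + ρ := by linarith
  have hc : ρ * condRenyi ρ p = Real.logb 2 (renyiSum ρ p) := by
    have : (1 / (1 + ρ)) / (1 - 1 / (1 + ρ)) = 1 / ρ := by field_simp; simp [hρ.ne']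
    rw [condRenyi, this, one_div_one_div, renyiSum]
    field_simp
  rw [mul_add, hc, Real.rpow_add two_pos, Real.rpow_logb two_pos (by norm_num) hp, mul_comm ρ,
    Real.rpow_mul two_pos.le]

/-- Ordering `X` by increasing `f` gives a guessing order. -/
lemma exists_guess_of_key {X : Type*} [Fintype X] (f : X → ℝ) :
    ∃ G : X → ℕ, Set.BijOn G Set.univ (Set.Icc 1 (Fintype.card X)) ∧
      ∀ x, G x ≤ (Finset.univ.filter fun x' => f x' ≤ f x).card := by
  classical
  let k : X → ℝ ×ₗ Fin (Fintype.card X) := fun x => toLex (f x, Fintype.equivFin X x)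
  have hk : Function.Injective k := fun x y h => by
    simpa [k] using congrArg (fun z => (ofLex z).2) h
  let G : X → ℕ := fun x => (Finset.univ.filter fun x' => k x' ≤ k x).card
  have hlt : ∀ x y, k x < k y → G x < G y := fun x y h => by
    refine Finset.card_lt_card (Finset.ssubset_iff_of_subset ?_ |>.2 ⟨y, ?_⟩)
    · intro z hz
      simp only [Finset.mem_filter, Finset.mem_univ, true_and] at hz ⊢
      exact hz.trans h.le
    · simpa using h
  have hinj : Function.Injective G := fun x y h => by
    rcases lt_trichotomy (k x) (k y) with h' | h' | h'
    · exact absurd h (hlt _ _ h').ne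
    · exact hk h'
    · exact absurd h (hlt _ _ h').ne'
  have hmaps : ∀ x, G x ∈ Finset.Icc 1 (Fintype.card X) := fun x => by
    rw [Finset.mem_Icc]
    exact ⟨Finset.card_pos.2 ⟨x, by simp⟩, Finset.card_le_univ _⟩
  refine ⟨G, ⟨fun x _ => by simpa using hmaps x, hinj.injOn, ?_⟩, fun x => ?_⟩
  · have := Finset.surjOn_of_injOn_of_card_le (s := Finset.univ) G (fun x _ => hmaps x) hinj.injOn
      (by simp)
    simpa using this
  · refine Finset.card_le_card fun z hz => ?_
    simp only [Finset.mem_filter, Finset.mem_univ, true_and] at hz ⊢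
    rcases Prod.Lex.le_iff.1 hz with h | h
    · exact h.le
    · exact h.1.le

/-- Guessing the elements of short lists first. -/
lemma exists_guess_of_lists {X S : Type*} [Fintype X] [Fintype S] (L : S → Finset X) :
    ∃ G : X → ℕ, Set.BijOn G Set.univ (Set.Icc 1 (Fintype.card X)) ∧
      ∀ s, ∀ x ∈ L s, G x ≤ Fintype.card S * (L s).card := by
  classical
  let f : X → ℕ := fun x => if ∃ s, x ∈ L s then sInf {k | ∃ s, x ∈ L s ∧ (L s).card = k}
    else Fintype.card X + 1
  obtain ⟨G, hG, hGf⟩ := exists_guess_of_key fun x => (f x : ℝ)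
  refine ⟨G, hG, fun s x hx => (hGf x).trans ?_⟩
  have hfx : f x ≤ (L s).card := by
    simp only [f, if_pos (⟨s, hx⟩ : ∃ s, x ∈ L s)]
    exact Nat.sInf_le ⟨s, hx, rfl⟩
  have hsub : (Finset.univ.filter fun x' => (f x' : ℝ) ≤ f x) ⊆
      Finset.univ.biUnion fun s' => if (L s').card ≤ (L s).card then L s' else ∅ := by
    intro z hz
    simp only [Finset.mem_filter, Finset.mem_univ, true_and, Nat.cast_le] at hz
    have hz := hz.trans hfx
    by_cases hcov : ∃ s, z ∈ L s
    · simp only [f, if_pos hcov] at hz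
      obtain ⟨s', hs', hs''⟩ := Nat.sInf_mem (s := {k | ∃ s, z ∈ L s ∧ (L s).card = k})
        (hcov.imp' (fun s => (L s).card) fun s h => ⟨s, h, rfl⟩)
      refine Finset.mem_biUnion.2 ⟨s', Finset.mem_univ _, ?_⟩
      rwa [if_pos (hs''.trans_le hz)]
    · simp only [f, if_neg hcov] at hz
      have := (L s).card_le_univ
      omega
  refine (Finset.card_le_card hsub).trans (Finset.card_biUnion_le_card_mul _ _ _ fun s' _ => ?_)
  split_ifs with h
  · exact h
  · simp

lemma exists_isGuess {X V : Type*} [Fintype X] : ∃ G : V → X → ℕ, IsGuess G := by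
  obtain ⟨G, hG, -⟩ := exists_guess_of_key fun _ : X => 0
  exact ⟨fun _ => G, fun _ => hG⟩

lemma exists_indexing_of_fibers {X : Type*} (A : Finset X) {k : ℕ} (hk : 0 < k) :
    ∃ f : A → Fin ⌈(A.card : ℝ) / k⌉₊, ∀ i, ∀ T : Finset A, (∀ x ∈ T, f x = i) → T.card ≤ k := by
  have hk' : (0 : ℝ) < k := Nat.cast_pos.2 hk
  refine ⟨fun x => ⟨A.equivFin x / k, ?_⟩, fun i T hT => ?_⟩
  · have h1 : ((A.equivFin x / k : ℕ) : ℝ) ≤ (A.equivFin x : ℕ) / k := Nat.cast_div_le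
    have h2 : ((A.equivFin x : ℕ) : ℝ) / k < A.card / k := by
      gcongr
      exact (A.equivFin x).2
    exact_mod_cast (h1.trans_lt h2).trans_le (Nat.le_ceil _)
  · have := Finset.card_le_card_of_injOn (s := T) (t := Finset.Ico (i * k) (i * k + k))
      (fun x => (A.equivFin x : ℕ)) (fun x hx => ?_) (fun x _ y _ h => ?_)
    · simpa using this
    · have h := congrArg Fin.val (hT x hx)
      simp only at h
      rw [Finset.mem_coe, Finset.mem_Ico, ← h]
      exact ⟨Nat.div_mul_le_self _ _, Nat.lt_div_mul_add hk⟩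
    · exact A.equivFin.injective (Fin.ext h)

/-- A partition of `X` into at most `N` cells in which the cell of `x` has at most `l x` elements;
`l x = 0` stands for the absence of a constraint. -/
lemma exists_code {X : Type*} [Fintype X] [DecidableEq X] (l : X → ℕ) (N : ℕ)
    (hN : 2 * ∑ x, 1 / (l x : ℝ) + Real.logb 2 (Fintype.card X) + 2 ≤ N) :
    ∃ f : X → Fin N, ∀ x, l x ≠ 0 → (Finset.univ.filter fun x' => f x' = f x).card ≤ l x := by
  classical
  set J := Nat.log 2 (Fintype.card X) with hJ
  let key : X → Fin (J + 2) := fun x =>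
    ⟨if l x = 0 then J + 1 else min (Nat.log 2 (l x)) (J + 1), by split_ifs <;> omega⟩
  let A : Fin (J + 2) → Finset X := fun j => Finset.univ.filter fun x => key x = j
  have hkeyle : ∀ x, l x ≠ 0 → 2 ^ (key x : ℕ) ≤ l x := fun x hx => by
    simp only [key, if_neg hx]
    exact (Nat.pow_le_pow_right two_pos (min_le_left _ _)).trans (Nat.pow_log_le_self 2 hx)
  have hkeylt : ∀ x, (key x : ℕ) < J + 1 → l x ≠ 0 ∧ l x < 2 ^ ((key x : ℕ) + 1) := fun x hx => by
    by_cases h0 : l x = 0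
    · simp [key, h0] at hx
    · refine ⟨h0, ?_⟩
      simp only [key, if_neg h0] at hx ⊢
      rw [min_eq_left (by omega)]
      exact Nat.lt_pow_succ_log_self one_lt_two _
  choose F hF using fun j : Fin (J + 2) =>
    exists_indexing_of_fibers (A j) (k := 2 ^ (j : ℕ)) (by positivity)
  have hcell : ∀ j : Fin (J + 2), (⌈((A j).card : ℝ) / (2 ^ (j : ℕ) : ℕ)⌉₊ : ℝ) ≤
      2 * ∑ x ∈ A j, 1 / (l x : ℝ) + 1 := fun j => by
    have hnn : 0 ≤ ∑ x ∈ A j, 1 / (l x : ℝ) := Finset.sum_nonneg fun x _ => by positivity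
    by_cases hj : (j : ℕ) < J + 1
    · refine (Nat.ceil_lt_add_one (by positivity)).le.trans (add_le_add_left ?_ _)
      rw [Finset.mul_sum, div_eq_mul_one_div, ← nsmul_eq_mul]
      refine Finset.card_nsmul_le_sum _ _ _ fun x hx => ?_
      obtain rfl : key x = j := by simpa [A] using hx
      obtain ⟨h0, h1⟩ := hkeylt x hj
      have h2 : (l x : ℝ) ≤ 2 * 2 ^ (key x : ℕ) := by
        have : (l x : ℝ) < 2 ^ ((key x : ℕ) + 1) := by exact_mod_cast h1
        rw [pow_succ] at this
        linarith
      have h3 : (0 : ℝ) < l x := by positivity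
      push_cast
      rw [mul_one_div, div_le_div_iff₀ (by positivity) h3]
      linarith
    · have hj' : (j : ℕ) = J + 1 := by omega
      have : ⌈((A j).card : ℝ) / (2 ^ (j : ℕ) : ℕ)⌉₊ ≤ 1 := by
        rw [Nat.ceil_le, Nat.cast_one, div_le_one (by positivity), hj']
        exact_mod_cast (A j).card_le_univ.trans (Nat.lt_pow_succ_log_self one_lt_two _).le
      have : (⌈((A j).card : ℝ) / (2 ^ (j : ℕ) : ℕ)⌉₊ : ℝ) ≤ 1 := by exact_mod_cast this
      linarith
  have hcard :
      Fintype.card (Σ j : Fin (J + 2), Fin ⌈((A j).card : ℝ) / (2 ^ (j : ℕ) : ℕ)⌉₊) ≤ N := by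
    rw [Fintype.card_sigma]
    simp only [Fintype.card_fin]
    have hlog : (J : ℝ) ≤ Real.logb 2 (Fintype.card X) := by
      exact_mod_cast Real.natLog_le_logb (Fintype.card X) 2
    have hsum : ∑ j, ∑ x ∈ A j, 1 / (l x : ℝ) = ∑ x, 1 / (l x : ℝ) :=
      Finset.sum_fiberwise Finset.univ key _
    have := Finset.sum_le_sum fun (j : Fin (J + 2)) (_ : j ∈ Finset.univ) => hcell j
    rw [Finset.sum_add_distrib, ← Finset.mul_sum, hsum] at this
    simp only [Finset.sum_const, Finset.card_univ, Fintype.card_fin, nsmul_eq_mul, mul_one] at this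
    push_cast at this
    have : ((∑ j : Fin (J + 2), ⌈((A j).card : ℝ) / (2 ^ (j : ℕ) : ℕ)⌉₊ : ℕ) : ℝ) ≤ N := by
      push_cast
      linarith
    exact_mod_cast this
  obtain ⟨g⟩ := Function.Embedding.nonempty_of_card_le (hcard.trans_eq (Fintype.card_fin N).symm)
  have hmem : ∀ x, x ∈ A (key x) := fun x => by simp [A]
  refine ⟨fun x => g ⟨key x, F (key x) ⟨x, hmem x⟩⟩, fun x hx => ?_⟩
  refine le_trans ?_ (hkeyle x hx)
  have hkey : ∀ x', g ⟨key x', F (key x') ⟨x', hmem x'⟩⟩ = g ⟨key x, F (key x) ⟨x, hmem x⟩⟩ →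
      ∃ h : x' ∈ A (key x), F (key x) ⟨x', h⟩ = F (key x) ⟨x, hmem x⟩ := fun x' h => by
    have h := g.injective h
    have h1 : key x' = key x := congrArg Sigma.fst h
    have h2 : x' ∈ A (key x) := h1 ▸ hmem x'
    refine ⟨h2, ?_⟩
    have : (⟨key x', F (key x') ⟨x', hmem x'⟩⟩ :
        Σ j : Fin (J + 2), Fin ⌈((A j).card : ℝ) / (2 ^ (j : ℕ) : ℕ)⌉₊) =
        ⟨key x, F (key x) ⟨x', h2⟩⟩ := by
      congr! 1
      congr!
    rw [this] at h
    exact eq_of_heq (Sigma.mk.inj h).2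
  calc _ ≤ ((Finset.univ.filter fun z : A (key x) => F (key x) z = F (key x) ⟨x, hmem x⟩).map
        (Function.Embedding.subtype _)).card := by
        refine Finset.card_le_card fun z hz => ?_
        obtain ⟨h, h'⟩ := hkey z (by simpa using hz)
        simp only [Finset.mem_map, Finset.mem_filter, Finset.mem_univ, true_and]
        exact ⟨⟨z, h⟩, h', rfl⟩
    _ ≤ _ := by
        rw [Finset.card_map]
        exact hF (key x) (F (key x) ⟨x, hmem x⟩) _ (by simp)

lemma sum_one_div_isGuess_le {X V : Type*} [Fintype X] {G : V → X → ℕ} (hG : IsGuess G) (v : V) :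
    ∑ x, 1 / (G v x : ℝ) ≤ 1 + Real.log (Fintype.card X) := by
  classical
  have h : ∑ x, 1 / (G v x : ℝ) = ∑ k ∈ Finset.Icc 1 (Fintype.card X), 1 / (k : ℝ) :=
    Finset.sum_bij (fun x _ => G v x) (fun x _ => by simpa using (hG v).mapsTo (Set.mem_univ x))
      (fun x _ y _ h => (hG v).injOn (Set.mem_univ x) (Set.mem_univ y) h)
      (fun k hk => by
        obtain ⟨x, -, hx⟩ := (hG v).surjOn (by simpa using hk : k ∈ Set.Icc 1 (Fintype.card X))
        exact ⟨x, Finset.mem_univ x, hx⟩) (fun _ _ => rfl)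
  have := harmonic_le_one_add_log (Fintype.card X)
  rw [harmonic_eq_sum_Icc] at this
  rw [h]
  simpa using this

section SecretHint

variable {𝒳 𝒴 Mp Ms : Type*} [Fintype 𝒳] [Fintype 𝒴] [Fintype Mp] [Fintype Ms] {ρ : ℝ}
  {p : 𝒳 → 𝒴 → ℝ} {e : 𝒳 → 𝒴 → Mp × Ms → ℝ}

lemma eveAmbSH_le (hp0 : ∀ x y, 0 ≤ p x y) (he0 : ∀ x y m, 0 ≤ e x y m) {G : 𝒴 × Mp → 𝒳 → ℕ}
    (hG : IsGuess G) :
    eveAmbSH ρ p e ≤ ∑ x, ∑ y, ∑ mp, ∑ ms, p x y * e x y (mp, ms) * (G (y, mp) x : ℝ) ^ ρ := by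
  refine csInf_le ⟨0, ?_⟩ ⟨G, hG, rfl⟩
  rintro _ ⟨G', -, rfl⟩
  exact Finset.sum_nonneg fun x _ => Finset.sum_nonneg fun y _ => Finset.sum_nonneg fun mp _ =>
    Finset.sum_nonneg fun ms _ => mul_nonneg (mul_nonneg (hp0 x y) (he0 x y _)) (by positivity)

lemma eveAmbSH_le_renyiSum (hρ : 0 < ρ) (hp0 : ∀ x y, 0 ≤ p x y) (he0 : ∀ x y m, 0 ≤ e x y m)
    (he1 : ∀ x y, ∑ m, e x y m = 1) : eveAmbSH ρ p e ≤ renyiSum ρ p := by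
  have h1 : 0 < 1 + ρ := by linarith
  choose G hG hGle using fun y => exists_guess_of_key fun x => -p x y
  refine (eveAmbSH_le (G := fun v => G v.1) hp0 he0 fun v => hG v.1).trans ?_
  have hsum : ∀ x y, ∑ mp, ∑ ms, p x y * e x y (mp, ms) * (G y x : ℝ) ^ ρ =
      p x y * (G y x : ℝ) ^ ρ := fun x y => by
    simp only [← Finset.sum_mul, ← Finset.mul_sum]
    rw [← Fintype.sum_prod_type, he1, mul_one]
  simp only [hsum]
  rw [Finset.sum_comm]
  refine Finset.sum_le_sum fun y _ => ?_
  set s := ∑ x, p x y ^ (1 / (1 + ρ)) with hs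
  have hs0 : 0 ≤ s := Finset.sum_nonneg fun x _ => Real.rpow_nonneg (hp0 x y) _
  have hterm : ∀ x, p x y * (G y x : ℝ) ^ ρ ≤ p x y ^ (1 / (1 + ρ)) * s ^ ρ := fun x => by
    rcases (hp0 x y).eq_or_lt with h | h
    · rw [← h, zero_mul]
      positivity
    have hb : (G y x : ℝ) ≤ s * p x y ^ (-(1 / (1 + ρ))) := by
      refine (Nat.cast_le.2 (hGle y x)).trans ?_
      rw [Real.rpow_neg h.le, ← div_eq_mul_inv, le_div_iff₀ (Real.rpow_pos_of_pos h _),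
        ← nsmul_eq_mul]
      refine (Finset.card_nsmul_le_sum _ (fun x' => p x' y ^ (1 / (1 + ρ))) _
        fun x' hx' => ?_).trans (Finset.sum_le_sum_of_subset_of_nonneg (Finset.subset_univ _)
          fun x' _ _ => Real.rpow_nonneg (hp0 x' y) _)
      simp only [Finset.mem_filter, Finset.mem_univ, true_and, neg_le_neg_iff] at hx'
      exact Real.rpow_le_rpow h.le hx' (by positivity)
    calc p x y * (G y x : ℝ) ^ ρ ≤ p x y * (s * p x y ^ (-(1 / (1 + ρ)))) ^ ρ := by gcongr
      _ = p x y ^ (1 : ℝ) * p x y ^ (-(1 / (1 + ρ)) * ρ) * s ^ ρ := by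
          rw [Real.mul_rpow hs0 (Real.rpow_nonneg h.le _), ← Real.rpow_mul h.le, Real.rpow_one]
          ring
      _ = p x y ^ (1 / (1 + ρ)) * s ^ ρ := by
          rw [← Real.rpow_add h]
          congr 2
          field_simp
          ring
  refine (Finset.sum_le_sum fun x _ => hterm x).trans ?_
  rw [← Finset.sum_mul, ← hs]
  rcases hs0.eq_or_lt with h | h
  · rw [← h, zero_mul, Real.zero_rpow h1.ne']
  · rw [Real.rpow_add h, Real.rpow_one]

lemma eveAmbSH_le_bobListAmbSH (hρ : 0 < ρ) (hp0 : ∀ x y, 0 ≤ p x y)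
    (he0 : ∀ x y m, 0 ≤ e x y m) :
    eveAmbSH ρ p e ≤ (Fintype.card Ms : ℝ) ^ ρ * bobListAmbSH ρ p e := by
  choose G hG hGle using fun v : 𝒴 × Mp => exists_guess_of_lists fun ms : Ms =>
    Finset.univ.filter fun x' : 𝒳 => 0 < p x' v.1 * e x' v.1 (v.2, ms)
  refine (eveAmbSH_le hp0 he0 hG).trans ?_
  simp only [bobListAmbSH, Finset.mul_sum, Fintype.sum_prod_type]
  refine Finset.sum_le_sum fun x _ => Finset.sum_le_sum fun y _ => Finset.sum_le_sum fun mp _ =>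
    Finset.sum_le_sum fun ms _ => ?_
  rcases (mul_nonneg (hp0 x y) (he0 x y (mp, ms))).eq_or_lt with h | h
  · rw [← h]
    simp
  · rw [mul_left_comm, ← Real.mul_rpow (by positivity) (by positivity)]
    refine mul_le_mul_of_nonneg_left (Real.rpow_le_rpow (by positivity) ?_ hρ.le) h.le
    exact_mod_cast hGle (y, mp) ms x (by simpa using h)

lemma one_le_bobListAmbSH (hρ : 0 < ρ) (hp0 : ∀ x y, 0 ≤ p x y) (hp1 : ∑ x, ∑ y, p x y = 1)
    (he0 : ∀ x y m, 0 ≤ e x y m) (he1 : ∀ x y, ∑ m, e x y m = 1) : 1 ≤ bobListAmbSH ρ p e := by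
  calc (1 : ℝ) = ∑ x, ∑ y, ∑ m, p x y * e x y m := by
        simp only [← Finset.mul_sum, he1, mul_one, hp1]
    _ ≤ _ := by
        refine Finset.sum_le_sum fun x _ => Finset.sum_le_sum fun y _ =>
          Finset.sum_le_sum fun m _ => ?_
        rcases (mul_nonneg (hp0 x y) (he0 x y m)).eq_or_lt with h | h
        · rw [← h, zero_mul]
        · refine le_mul_of_one_le_right h.le (Real.one_le_rpow ?_ hρ.le)
          exact_mod_cast Finset.card_pos.2 ⟨x, by simpa using h⟩

lemma renyiSum_le_bobListAmbSH (hρ : 0 < ρ) (hp0 : ∀ x y, 0 ≤ p x y)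
    (he0 : ∀ x y m, 0 ≤ e x y m) (he1 : ∀ x y, ∑ m, e x y m = 1) :
    renyiSum ρ p ≤ ((Fintype.card Mp * Fintype.card Ms : ℕ) : ℝ) ^ ρ * bobListAmbSH ρ p e := by
  rw [bobListAmbSH, Finset.sum_comm, Finset.mul_sum]
  refine Finset.sum_le_sum fun y _ => ?_
  let L : Mp × Ms → Finset 𝒳 := fun m => Finset.univ.filter fun x' => 0 < p x' y * e x' y m
  have hq : ∀ x m, 0 ≤ p x y * e x y m := fun x m => mul_nonneg (hp0 x y) (he0 x y m)
  have hnot : ∀ x m, x ∉ L m → p x y * e x y m = 0 := fun x m h =>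
    ((hq x m).eq_or_lt.resolve_right (by simpa [L] using h)).symm
  have := rpow_sum_rpow_le_moment hρ (Finset.univ : Finset (Mp × Ms)) (fun x => p x y)
    (fun x m => p x y * e x y m) (fun x m => if 0 < p x y * e x y m then ((L m).card : ℝ) else 0)
    hq (fun x m => by split_ifs <;> positivity)
    (fun x m h => by
      split_ifs at h with h'
      · exact absurd (Nat.cast_eq_zero.1 h) (Finset.card_pos.2 ⟨x, by simpa [L] using h'⟩).ne'
      · exact ((hq x m).eq_or_lt.resolve_right h').symm)
    (fun x => by rw [← Finset.mul_sum, he1, mul_one]) 1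
    (fun m _ => by
      have : ∀ x, 1 / (if 0 < p x y * e x y m then ((L m).card : ℝ) else 0) =
          if 0 < p x y * e x y m then 1 / ((L m).card : ℝ) else 0 := fun x => by
        split_ifs <;> simp
      simp only [this]
      rw [← Finset.sum_filter, Finset.sum_const, nsmul_eq_mul, mul_one_div]
      exact div_self_le_one _)
  rw [mul_one, Finset.card_univ, Fintype.card_prod] at this
  refine this.trans_eq ?_
  congr 1
  refine Finset.sum_congr rfl fun x _ => Finset.sum_congr rfl fun m _ => ?_
  split_ifs with h
  · rfl
  · rw [((hq x m).eq_or_lt.resolve_right h).symm, zero_mul, zero_mul]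

/-- Eve's ambiguity when the public hint ranges over `C` only. -/
lemma renyiSum_le_eveAmbSH (hρ : 0 < ρ) (hp0 : ∀ x y, 0 ≤ p x y) (he0 : ∀ x y m, 0 ≤ e x y m)
    (he1 : ∀ x y, ∑ m, e x y m = 1) (C : Finset Mp)
    (hC : ∀ x y m, m.1 ∉ C → e x y m = 0) :
    (1 + Real.log (Fintype.card 𝒳)) ^ (-ρ) * (renyiSum ρ p * (1 / (C.card : ℝ)) ^ ρ) ≤
      eveAmbSH ρ p e := by
  classical
  have hK : 0 < 1 + Real.log (Fintype.card 𝒳) := by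
    linarith [Real.log_natCast_nonneg (Fintype.card 𝒳)]
  obtain ⟨G₀, hG₀⟩ := exists_isGuess (X := 𝒳) (V := 𝒴 × Mp)
  refine le_csInf ⟨_, G₀, hG₀, rfl⟩ ?_
  rintro _ ⟨G, hG, rfl⟩
  have hpos : ∀ v x, 0 < G v x := fun v x => ((hG v).mapsTo (Set.mem_univ x)).1
  set E := ∑ x, ∑ y, ∑ mp, ∑ ms, p x y * e x y (mp, ms) * (G (y, mp) x : ℝ) ^ ρ with hE
  have hE0 : 0 ≤ E := Finset.sum_nonneg fun x _ => Finset.sum_nonneg fun y _ =>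
    Finset.sum_nonneg fun mp _ => Finset.sum_nonneg fun ms _ =>
      mul_nonneg (mul_nonneg (hp0 x y) (he0 x y _)) (by positivity)
  have hout : ∀ x y (f : Mp → ℝ), ∑ mp ∈ C, (∑ ms, p x y * e x y (mp, ms)) * f mp =
      ∑ mp, ∑ ms, p x y * e x y (mp, ms) * f mp := fun x y f => by
    simp only [← Finset.sum_mul]
    refine Finset.sum_subset (Finset.subset_univ _) fun mp _ hmp => ?_
    simp [hC x y (mp, _) hmp]
  have hmain : renyiSum ρ p ≤ (C.card * (1 + Real.log (Fintype.card 𝒳))) ^ ρ * E := by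
    rw [hE, Finset.sum_comm, Finset.mul_sum]
    refine Finset.sum_le_sum fun y _ => ?_
    simp only [← hout]
    exact rpow_sum_rpow_le_moment hρ C (fun x => p x y) (fun x mp => ∑ ms, p x y * e x y (mp, ms))
      (fun x mp => (G (y, mp) x : ℝ))
      (fun x mp => Finset.sum_nonneg fun ms _ => mul_nonneg (hp0 x y) (he0 x y _))
      (fun x mp => by positivity)
      (fun x mp h => absurd (Nat.cast_eq_zero.1 h) (hpos _ _).ne')
      (fun x => by
        have := hout x y fun _ => 1
        simp only [mul_one] at this
        rw [this]
        simp only [← Finset.mul_sum]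
        rw [← Fintype.sum_prod_type, he1, mul_one]) _
      (fun mp _ => sum_one_div_isGuess_le hG (y, mp))
  rcases C.card.eq_zero_or_pos with hc | hc
  · simpa [hc, Real.zero_rpow hρ.ne'] using hE0
  · have hc : (0 : ℝ) < C.card := Nat.cast_pos.2 hc
    rw [Real.mul_rpow hc.le hK.le] at hmain
    have h1 := Real.rpow_pos_of_pos hc ρ
    have h2 := Real.rpow_pos_of_pos hK ρ
    rw [Real.rpow_neg hK.le, one_div, Real.inv_rpow hc.le]
    calc _ ≤ ((1 + Real.log (Fintype.card 𝒳)) ^ ρ)⁻¹ * (((C.card : ℝ) ^ ρ *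
            (1 + Real.log (Fintype.card 𝒳)) ^ ρ * E) * ((C.card : ℝ) ^ ρ)⁻¹) := by gcongr
      _ = E := by field_simp

lemma ceil_rpow_lt (hρ : 0 < ρ) {t : ℝ} (ht : 0 < t) :
    (⌈t⌉₊ : ℝ) ^ ρ < 1 + (2 * t) ^ ρ := by
  rcases le_or_gt t 1 with h | h
  · have h1 : (⌈t⌉₊ : ℝ) ≤ 1 := by
      exact_mod_cast Nat.ceil_le.2 (by simpa using h)
    have := Real.rpow_le_one (Nat.cast_nonneg _) h1 hρ.le
    have := Real.rpow_pos_of_pos (mul_pos two_pos ht) ρ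
    linarith
  · have h1 : (⌈t⌉₊ : ℝ) ≤ 2 * t := by linarith [Nat.ceil_lt_add_one ht.le]
    linarith [Real.rpow_le_rpow (Nat.cast_nonneg _) h1 hρ.le]

/-- A deterministic encoder with short lists. -/
lemma exists_encoder_bobListAmbSH_lt (hρ : 0 < ρ) (hp0 : ∀ x y, 0 ≤ p x y)
    (hp1 : ∑ x, ∑ y, p x y = 1) (T : Finset (Mp × Ms))
    (hT : 0 < T.card - Real.logb 2 (Fintype.card 𝒳) - 2) :
    ∃ e : 𝒳 → 𝒴 → Mp × Ms → ℝ, (∀ x y, ∑ m, e x y m = 1) ∧ (∀ x y m, e x y m = 0 ∨ e x y m = 1) ∧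
      (∀ x y m, m ∉ T → e x y m = 0) ∧ bobListAmbSH ρ p e <
        1 + renyiSum ρ p * (4 / (T.card - Real.logb 2 (Fintype.card 𝒳) - 2)) ^ ρ := by
  classical
  have h1 : 0 < 1 + ρ := by linarith
  set D := T.card - Real.logb 2 (Fintype.card 𝒳) - 2 with hD
  let s : 𝒴 → ℝ := fun y => ∑ x, p x y ^ (1 / (1 + ρ))
  have hs0 : ∀ y, 0 ≤ s y := fun y => Finset.sum_nonneg fun x _ => Real.rpow_nonneg (hp0 x y) _
  have hspos : ∀ x y, 0 < p x y → 0 < s y := fun x y h =>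
    Finset.sum_pos' (fun x _ => Real.rpow_nonneg (hp0 x y) _)
      ⟨x, Finset.mem_univ x, Real.rpow_pos_of_pos h _⟩
  let t : 𝒳 → 𝒴 → ℝ := fun x y => 2 * s y / D * p x y ^ (-(1 / (1 + ρ)))
  have htpos : ∀ x y, 0 < p x y → 0 < t x y := fun x y h =>
    mul_pos (div_pos (mul_pos two_pos (hspos x y h)) hT) (Real.rpow_pos_of_pos h _)
  have hl : ∀ y, 2 * ∑ x, 1 / (⌈t x y⌉₊ : ℝ) + Real.logb 2 (Fintype.card 𝒳) + 2 ≤ T.card := by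
    intro y
    have hx : ∀ x, 1 / (⌈t x y⌉₊ : ℝ) ≤ p x y ^ (1 / (1 + ρ)) * (D / (2 * s y)) := fun x => by
      rcases (hp0 x y).eq_or_lt with h | h
      · have : t x y = 0 := by
          simp only [t, ← h]
          rw [Real.zero_rpow (by simpa using h1.ne'), mul_zero]
        rw [this]
        have := hs0 y
        have := hT.le
        simp only [Nat.ceil_zero, Nat.cast_zero, div_zero, ← h]
        positivity
      · have := hspos x y h
        have h3 := Real.rpow_pos_of_pos h (1 / (1 + ρ))
        refine (one_div_le_one_div_of_le (htpos x y h) (Nat.le_ceil _)).trans_eq ?_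
        simp only [t]
        rw [Real.rpow_neg h.le]
        field_simp
    have hsum : ∑ x, 1 / (⌈t x y⌉₊ : ℝ) ≤ D / 2 := by
      refine (Finset.sum_le_sum fun x _ => hx x).trans ?_
      rw [← Finset.sum_mul]
      change s y * (D / (2 * s y)) ≤ D / 2
      rcases (hs0 y).eq_or_lt with h | h
      · rw [← h, zero_mul]
        linarith
      · exact le_of_eq (by field_simp)
    linarith
  choose f hf using fun y => exists_code (fun x => ⌈t x y⌉₊) T.card (hl y)
  let enc : 𝒳 → 𝒴 → Mp × Ms := fun x y => (T.equivFin.symm (f y x) : Mp × Ms)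
  have hencT : ∀ x y, enc x y ∈ T := fun x y => (T.equivFin.symm (f y x)).2
  have henc : ∀ x x' y, enc x' y = enc x y → f y x' = f y x := fun x x' y h =>
    T.equivFin.symm.injective (Subtype.ext h)
  refine ⟨fun x y m => if m = enc x y then 1 else 0, fun x y => by simp,
    fun x y m => by by_cases h : m = enc x y <;> simp [h], fun x y m hm => ?_, ?_⟩
  · exact if_neg fun h : m = enc x y => hm (h ▸ hencT x y)
  have hbob : bobListAmbSH ρ p (fun x y m => if m = enc x y then 1 else 0) ≤
      ∑ x, ∑ y, p x y * (⌈t x y⌉₊ : ℝ) ^ ρ := by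
    refine Finset.sum_le_sum fun x _ => Finset.sum_le_sum fun y _ => ?_
    simp only [mul_ite, mul_one, mul_zero, ite_mul, zero_mul, Finset.sum_ite_eq',
      Finset.mem_univ, if_true]
    rcases (hp0 x y).eq_or_lt with h | h
    · simp [← h]
    refine mul_le_mul_of_nonneg_left (Real.rpow_le_rpow (Nat.cast_nonneg _) ?_ hρ.le) h.le
    refine Nat.cast_le.2 ((Finset.card_le_card fun x' hx' => ?_).trans
      (hf y x (Nat.ceil_pos.2 (htpos x y h)).ne'))
    simp only [Finset.mem_filter, Finset.mem_univ, true_and] at hx' ⊢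
    by_contra hne
    rw [if_neg fun h => hne (henc _ _ _ h.symm)] at hx'
    exact hx'.false
  refine hbob.trans_lt ?_
  have hle : ∀ x y, p x y * (⌈t x y⌉₊ : ℝ) ^ ρ ≤ p x y * (1 + (2 * t x y) ^ ρ) := fun x y => by
    rcases (hp0 x y).eq_or_lt with h | h
    · simp [← h]
    · exact mul_le_mul_of_nonneg_left (ceil_rpow_lt hρ (htpos x y h)).le h.le
  have hlt : ∑ x, ∑ y, p x y * (⌈t x y⌉₊ : ℝ) ^ ρ < ∑ x, ∑ y, p x y * (1 + (2 * t x y) ^ ρ) := by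
    obtain ⟨x, -, hx⟩ := Finset.exists_ne_zero_of_sum_ne_zero (hp1.trans_ne one_ne_zero)
    obtain ⟨y, -, hy⟩ := Finset.exists_ne_zero_of_sum_ne_zero hx
    have hy : 0 < p x y := (hp0 x y).lt_of_ne' hy
    refine Finset.sum_lt_sum (fun x _ => Finset.sum_le_sum fun y _ => hle x y)
      ⟨x, Finset.mem_univ x, Finset.sum_lt_sum (fun y _ => hle x y) ⟨y, Finset.mem_univ y, ?_⟩⟩
    exact mul_lt_mul_of_pos_left (ceil_rpow_lt hρ (htpos x y hy)) hy
  refine hlt.trans_eq ?_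
  have hterm : ∀ x y, p x y * (2 * t x y) ^ ρ =
      p x y ^ (1 / (1 + ρ)) * (s y ^ ρ * (4 / D) ^ ρ) := fun x y => by
    rcases (hp0 x y).eq_or_lt with h | h
    · rw [← h, Real.zero_rpow (by positivity), zero_mul, zero_mul]
    have h4 : 2 * t x y = p x y ^ (-(1 / (1 + ρ))) * (s y * (4 / D)) := by
      simp only [t]
      ring
    have hD4 : 0 ≤ 4 / D := by positivity
    rw [h4, Real.mul_rpow (Real.rpow_nonneg h.le _) (mul_nonneg (hs0 y) hD4),
      Real.mul_rpow (hs0 y) hD4, ← mul_assoc, ← Real.rpow_mul h.le]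
    nth_rw 1 [← Real.rpow_one (p x y)]
    rw [← Real.rpow_add h]
    congr 2
    field_simp
    ring
  simp only [mul_add, mul_one, Finset.sum_add_distrib, hp1, hterm]
  rw [Finset.sum_comm, renyiSum, Finset.sum_mul]
  congr 1
  refine Finset.sum_congr rfl fun y _ => ?_
  rw [← Finset.sum_mul, ← mul_assoc]
  congr 1
  change s y * s y ^ ρ = s y ^ (1 + ρ)
  rcases (hs0 y).eq_or_lt with h | h
  · rw [← h, zero_mul, Real.zero_rpow h1.ne']
  · rw [Real.rpow_add h, Real.rpow_one]

end SecretHint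

/-- Theorem 11 (secret hint, list version). -/
theorem secret_hint_list
    {𝒳 𝒴 Mp Ms : Type*} [Fintype 𝒳] [Fintype 𝒴] [Fintype Mp] [Fintype Ms]
    (ρ : ℝ) (hρ : 0 < ρ)
    (p : 𝒳 → 𝒴 → ℝ) (hp0 : ∀ x y, 0 ≤ p x y) (hp1 : ∑ x : 𝒳, ∑ y : 𝒴, p x y = 1)
    (hM : Real.logb 2 (Fintype.card 𝒳) + 2 <
      ((Fintype.card Mp * Fintype.card Ms : ℕ) : ℝ)) :
    (∀ c : ℕ, 0 < c → c ≤ Fintype.card Mp →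
      Real.logb 2 (Fintype.card 𝒳) + 2 < ((c * Fintype.card Ms : ℕ) : ℝ) →
      ∃ e : 𝒳 → 𝒴 → Mp × Ms → ℝ,
        (∀ x y m, 0 ≤ e x y m) ∧ (∀ x y, ∑ m : Mp × Ms, e x y m = 1) ∧
        (∀ x y m, e x y m = 0 ∨ e x y m = 1) ∧
        bobListAmbSH ρ p e <
          1 + (2 : ℝ) ^ (ρ * (condRenyi ρ p -
            Real.logb 2 (((c * Fintype.card Ms : ℕ) : ℝ) -
              Real.logb 2 (Fintype.card 𝒳) - 2) + 2)) ∧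
        (1 + Real.log (Fintype.card 𝒳)) ^ (-ρ) *
            (2 : ℝ) ^ (ρ * (condRenyi ρ p - Real.logb 2 (c : ℝ))) ≤
          eveAmbSH ρ p e) ∧
    (∀ e : 𝒳 → 𝒴 → Mp × Ms → ℝ,
      (∀ x y m, 0 ≤ e x y m) → (∀ x y, ∑ m : Mp × Ms, e x y m = 1) →
      bobListAmbSH ρ p e ≥
        max ((2 : ℝ) ^ (ρ * (condRenyi ρ p -
          Real.logb 2 ((Fintype.card Mp * Fintype.card Ms : ℕ) : ℝ)))) 1 ∧
      eveAmbSH ρ p e ≤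
        min ((Fintype.card Ms : ℝ) ^ ρ * bobListAmbSH ρ p e)
          ((2 : ℝ) ^ (ρ * condRenyi ρ p))) := by
  have hS := renyiSum_pos ρ hp0 hp1
  refine ⟨fun c hc hcM hcD => ?_, fun e he0 he1 => ⟨max_le ?_ ?_, le_min ?_ ?_⟩⟩
  · obtain ⟨C, -, hC⟩ := Finset.exists_subset_card_eq (s := (Finset.univ : Finset Mp)) hcM
    have hT : (C ×ˢ (Finset.univ : Finset Ms)).card = c * Fintype.card Ms := by
      rw [Finset.card_product, hC, Finset.card_univ]
    have hD : 0 < ((c * Fintype.card Ms : ℕ) : ℝ) - Real.logb 2 (Fintype.card 𝒳) - 2 := by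
      linarith
    obtain ⟨e, he1, he01, heT, hbob⟩ := exists_encoder_bobListAmbSH_lt hρ hp0 hp1
      (C ×ˢ (Finset.univ : Finset Ms)) (by rwa [hT])
    have he0 : ∀ x y m, 0 ≤ e x y m := fun x y m => by
      rcases he01 x y m with h | h <;> simp [h]
    refine ⟨e, he0, he1, he01, ?_, ?_⟩
    · rw [hT] at hbob
      rwa [sub_add, sub_eq_add_neg, two_rpow_mul_condRenyi_add hρ hS, neg_sub,
        Real.rpow_sub two_pos, Real.rpow_logb two_pos (by norm_num) hD,
        show (2 : ℝ) ^ (2 : ℝ) = 4 by norm_num]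
    · have := renyiSum_le_eveAmbSH hρ hp0 he0 he1 C fun x y m hm => heT x y m (by simpa using hm)
      rw [hC, one_div] at this
      rwa [sub_eq_add_neg, two_rpow_mul_condRenyi_add hρ hS, Real.rpow_neg two_pos.le,
        Real.rpow_logb two_pos (by norm_num) (Nat.cast_pos.2 hc)]
  · have hM0 : (0 : ℝ) < ((Fintype.card Mp * Fintype.card Ms : ℕ) : ℝ) := by
      have : 0 ≤ Real.logb 2 (Fintype.card 𝒳) :=
        div_nonneg (Real.log_natCast_nonneg _) (Real.log_nonneg one_le_two)
      linarith
    rw [sub_eq_add_neg, two_rpow_mul_condRenyi_add hρ hS, Real.rpow_neg two_pos.le,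
      Real.rpow_logb two_pos (by norm_num) hM0, Real.inv_rpow hM0.le, ← div_eq_mul_inv,
      div_le_iff₀' (Real.rpow_pos_of_pos hM0 _)]
    exact renyiSum_le_bobListAmbSH hρ hp0 he0 he1
  · exact one_le_bobListAmbSH hρ hp0 hp1 he0 he1
  · exact eveAmbSH_le_bobListAmbSH hρ hp0 he0
  · have := two_rpow_mul_condRenyi_add hρ hS 0
    rw [add_zero, Real.rpow_zero, Real.one_rpow, mul_one] at this
    rw [this]
    exact eveAmbSH_le_renyiSum hρ hp0 he0 he1
end
end

section
/- (Secret key, list version.) Suppose ⌊|𝒨|/|𝒦|⌋·|𝒦| > log|𝒳| + 2. For every positive integer c with c·|𝒦| ≤ |𝒨| and c·|𝒦| > log|𝒳| + 2, there is a {0,1}-valued choice of Alice's encoder for which Bob's list ambiguity satisfies 𝒜_B^l < 1 + 2^{ρ(H_{1/(1+ρ)}(X|Y) − log(c·|𝒦| − log|𝒳| − 2) + 2)} and Eve's ambiguity satisfies 𝒜_E ≥ (1 + ln|𝒳|)^{−ρ} · 2^{ρ(H_{1/(1+ρ)}(X|Y) − log c)}. Conversely, for every choice of Alice's encoder, 𝒜_B^l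 ≥ max( 2^{ρ(H_{1/(1+ρ)}(X|Y) − log|𝒨|)}, 1 ) and 𝒜_E ≤ min( |𝒦|^ρ · 𝒜_B^l, 2^{ρ H_{1/(1+ρ)}(X|Y)} ). -/
open scoped BigOperators

noncomputable section

/-- Bob's guessing ambiguity `𝒜_B^g` in the secret-key scenario: Bob sees `(Y, K, M)`,
where the key `K` is independent of `(X,Y)` and uniform over `𝒦`. -/
def bobGuessAmbSK {𝒳 𝒴 𝒦 𝒨 : Type*} [Fintype 𝒳] [Fintype 𝒴] [Fintype 𝒦] [Fintype 𝒨]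
    (ρ : ℝ) (p : 𝒳 → 𝒴 → ℝ) (e : 𝒳 → 𝒴 → 𝒦 → 𝒨 → ℝ) : ℝ :=
  sInf {r : ℝ | ∃ G : 𝒴 × 𝒦 × 𝒨 → 𝒳 → ℕ, IsGuess G ∧
    r = ∑ x : 𝒳, ∑ y : 𝒴, ∑ k : 𝒦, ∑ m : 𝒨,
      p x y * (Fintype.card 𝒦 : ℝ)⁻¹ * e x y k m * (G (y, k, m) x : ℝ) ^ ρ}

/-- Bob's list ambiguity `𝒜_B^l` in the secret-key scenario. -/
def bobListAmbSK {𝒳 𝒴 𝒦 𝒨 : Type*} [Fintype 𝒳] [Fintype 𝒴] [Fintype 𝒦] [Fintype 𝒨]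
    (ρ : ℝ) (p : 𝒳 → 𝒴 → ℝ) (e : 𝒳 → 𝒴 → 𝒦 → 𝒨 → ℝ) : ℝ :=
  ∑ x : 𝒳, ∑ y : 𝒴, ∑ k : 𝒦, ∑ m : 𝒨,
    p x y * (Fintype.card 𝒦 : ℝ)⁻¹ * e x y k m *
      (((Finset.univ.filter fun x' : 𝒳 => 0 < p x' y * e x' y k m).card : ℝ)) ^ ρ

/-- Eve's ambiguity `𝒜_E` in the secret-key scenario: Eve sees only `(Y, M)`. -/
def eveAmbSK {𝒳 𝒴 𝒦 𝒨 : Type*} [Fintype 𝒳] [Fintype 𝒴] [Fintype 𝒦] [Fintype 𝒨]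
    (ρ : ℝ) (p : 𝒳 → 𝒴 → ℝ) (e : 𝒳 → 𝒴 → 𝒦 → 𝒨 → ℝ) : ℝ :=
  sInf {r : ℝ | ∃ G : 𝒴 × 𝒨 → 𝒳 → ℕ, IsGuess G ∧
    r = ∑ x : 𝒳, ∑ y : 𝒴, ∑ k : 𝒦, ∑ m : 𝒨,
      p x y * (Fintype.card 𝒦 : ℝ)⁻¹ * e x y k m * (G (y, m) x : ℝ) ^ ρ}

theorem exists_bijOn_le_card_filter {X α : Type*} [Fintype X] [LinearOrder α] (f : X → α) :
    ∃ g : X → ℕ, Set.BijOn g Set.univ (Set.Icc 1 (Fintype.card X)) ∧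
      ∀ x, g x ≤ (Finset.univ.filter fun x' => f x' ≤ f x).card := by
  classical
  let a := Fintype.equivFin X
  let τ := Tuple.sort (f ∘ a.symm)
  have hmono : Monotone ((f ∘ a.symm) ∘ τ) := Tuple.monotone_sort _
  refine ⟨fun x => (τ.symm (a x) : ℕ) + 1, ⟨?_, ?_, ?_⟩, ?_⟩
  · intro x _
    have := (τ.symm (a x)).isLt
    simp only [Set.mem_Icc]
    omega
  · intro x _ x' _ h
    have h' : (τ.symm (a x) : ℕ) = τ.symm (a x') := by simpa using h
    exact a.injective (τ.symm.injective (Fin.ext h'))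
  · rintro n ⟨h1, h2⟩
    refine ⟨a.symm (τ ⟨n - 1, by omega⟩), Set.mem_univ _, ?_⟩
    simp only [Equiv.apply_symm_apply, Equiv.symm_apply_apply]
    omega
  · intro x
    have hcard : (τ.symm (a x) : ℕ) + 1 = (Finset.Iic (τ.symm (a x))).card := by simp
    refine hcard.trans_le (Finset.card_le_card_of_injOn (fun i => a.symm (τ i)) ?_ ?_)
    · intro i hi
      have := hmono (Finset.mem_Iic.1 hi)
      simpa using this
    · exact (a.symm.injective.comp τ.injective).injOn

theorem exists_bijOn_le_card_mul_card {X K : Type*} [Fintype X] [Fintype K] [Nonempty K]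
    (L : K → Finset X) :
    ∃ g : X → ℕ, Set.BijOn g Set.univ (Set.Icc 1 (Fintype.card X)) ∧
      ∀ k, ∀ x ∈ L k, g x ≤ Fintype.card K * (L k).card := by
  classical
  let size : X → K → ℕ := fun x k => if x ∈ L k then (L k).card else Fintype.card X + 1
  let f : X → ℕ := fun x => Finset.univ.inf' Finset.univ_nonempty (size x)
  obtain ⟨g, hg, hle⟩ := exists_bijOn_le_card_filter f
  refine ⟨g, hg, fun k x hx => (hle x).trans ?_⟩
  have hfx : f x ≤ (L k).card := by
    have : f x ≤ size x k := Finset.inf'_le _ (Finset.mem_univ k)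
    simpa [size, hx] using this
  have hsub : (Finset.univ.filter fun x' => f x' ≤ f x) ⊆
      (Finset.univ.filter fun k' => (L k').card ≤ (L k).card).biUnion L := by
    intro x' hx'
    have hx'' : f x' ≤ (L k).card := (Finset.mem_filter.1 hx').2.trans hfx
    obtain ⟨k', -, hk'⟩ := Finset.exists_mem_eq_inf' Finset.univ_nonempty (size x')
    have hsize : size x' k' ≤ (L k).card := hk' ▸ hx''
    have hmem : x' ∈ L k' := by
      by_contra hmem
      have := (L k).card_le_univ
      simp only [size, hmem, if_false] at hsize
      omega
    simp only [size, hmem, if_true] at hsize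
    simp only [Finset.mem_biUnion, Finset.mem_filter, Finset.mem_univ, true_and]
    exact ⟨k', hsize, hmem⟩
  refine (Finset.card_le_card hsub).trans ((Finset.card_biUnion_le_card_mul _ _ (L k).card ?_).trans
    (Nat.mul_le_mul_right _ (Finset.card_le_univ _)))
  intro k' hk'
  exact (Finset.mem_filter.1 hk').2

theorem rpow_sum_le_sum_mul_rpow {ι : Type*} {ρ : ℝ} (hρ : 0 < ρ) (s : Finset ι) (q w : ι → ℝ)
    (hq : ∀ i ∈ s, 0 ≤ q i) (hw : ∀ i ∈ s, 0 < w i) {B : ℝ} (hB : ∑ i ∈ s, (w i)⁻¹ ≤ B) :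
    (∑ i ∈ s, q i ^ (1 / (1 + ρ))) ^ (1 + ρ) ≤ (∑ i ∈ s, q i * w i ^ ρ) * B ^ ρ := by
  have h1 : (0 : ℝ) < 1 + ρ := by linarith
  have hconj : (1 + ρ).HolderConjugate ((1 + ρ) / ρ) := by
    rw [Real.holderConjugate_iff]
    refine ⟨by linarith, ?_⟩
    field_simp
  have hH := Real.inner_le_Lp_mul_Lq_of_nonneg s hconj
    (f := fun i => (q i * w i ^ ρ) ^ (1 / (1 + ρ))) (g := fun i => ((w i)⁻¹) ^ (ρ / (1 + ρ)))
    (fun i hi => by have := hq i hi; have := hw i hi; positivity)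
    (fun i hi => by have := hw i hi; positivity)
  have hL : ∑ i ∈ s, (q i * w i ^ ρ) ^ (1 / (1 + ρ)) * ((w i)⁻¹) ^ (ρ / (1 + ρ)) =
      ∑ i ∈ s, q i ^ (1 / (1 + ρ)) := by
    refine Finset.sum_congr rfl fun i hi => ?_
    have hwi := hw i hi
    rw [Real.mul_rpow (hq i hi) (by positivity), ← Real.rpow_mul hwi.le, Real.inv_rpow hwi.le,
      mul_one_div, mul_assoc, mul_inv_cancel₀ (by positivity), mul_one]
  have hR1 : ∑ i ∈ s, ((q i * w i ^ ρ) ^ (1 / (1 + ρ))) ^ (1 + ρ) = ∑ i ∈ s, q i * w i ^ ρ := by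
    refine Finset.sum_congr rfl fun i hi => ?_
    have := hq i hi
    have := hw i hi
    rw [← Real.rpow_mul (by positivity), one_div_mul_cancel h1.ne', Real.rpow_one]
  have hR2 : ∑ i ∈ s, (((w i)⁻¹) ^ (ρ / (1 + ρ))) ^ ((1 + ρ) / ρ) = ∑ i ∈ s, (w i)⁻¹ := by
    refine Finset.sum_congr rfl fun i hi => ?_
    have := hw i hi
    rw [← Real.rpow_mul (by positivity), div_mul_div_cancel₀ h1.ne', div_self hρ.ne', Real.rpow_one]
  simp only [hL, hR1, hR2] at hH
  have hQ : 0 ≤ ∑ i ∈ s, q i * w i ^ ρ := Finset.sum_nonneg fun i hi => by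
    have := hq i hi
    have := hw i hi
    positivity
  have hW : 0 ≤ ∑ i ∈ s, (w i)⁻¹ := Finset.sum_nonneg fun i hi => by
    have := hw i hi
    positivity
  have hS : 0 ≤ ∑ i ∈ s, q i ^ (1 / (1 + ρ)) :=
    Finset.sum_nonneg fun i hi => Real.rpow_nonneg (hq i hi) _
  calc (∑ i ∈ s, q i ^ (1 / (1 + ρ))) ^ (1 + ρ)
      ≤ ((∑ i ∈ s, q i * w i ^ ρ) ^ (1 / (1 + ρ)) *
          (∑ i ∈ s, (w i)⁻¹) ^ (1 / ((1 + ρ) / ρ))) ^ (1 + ρ) :=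
        Real.rpow_le_rpow hS hH h1.le
    _ = (∑ i ∈ s, q i * w i ^ ρ) * (∑ i ∈ s, (w i)⁻¹) ^ ρ := by
        rw [Real.mul_rpow (by positivity) (by positivity), ← Real.rpow_mul hQ, ← Real.rpow_mul hW,
          one_div_mul_cancel h1.ne', Real.rpow_one, one_div_div, div_mul_cancel₀ _ h1.ne']
    _ ≤ (∑ i ∈ s, q i * w i ^ ρ) * B ^ ρ := by gcongr

theorem two_rpow_mul_condRenyi {X Y : Type*} [Fintype X] [Fintype Y] {ρ : ℝ} (hρ : 0 < ρ)
    (p : X → Y → ℝ) (hp0 : ∀ x y, 0 ≤ p x y) (hp1 : ∑ x : X, ∑ y : Y, p x y = 1) :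
    (2 : ℝ) ^ (ρ * condRenyi ρ p) = ∑ y : Y, (∑ x : X, p x y ^ (1 / (1 + ρ))) ^ (1 + ρ) := by
  have h1 : (0 : ℝ) < 1 + ρ := by linarith
  have hpos : 0 < ∑ y : Y, (∑ x : X, p x y ^ (1 / (1 + ρ))) ^ (1 + ρ) := by
    obtain ⟨x, -, hx⟩ := Finset.exists_ne_zero_of_sum_ne_zero (hp1.trans_ne one_ne_zero)
    obtain ⟨y, -, hy⟩ := Finset.exists_ne_zero_of_sum_ne_zero hx
    have hpxy : 0 < p x y := (hp0 x y).lt_of_ne' hy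
    have hS : ∀ y, 0 ≤ ∑ x : X, p x y ^ (1 / (1 + ρ)) := fun y =>
      Finset.sum_nonneg fun x _ => Real.rpow_nonneg (hp0 x y) _
    refine Finset.sum_pos' (fun y _ => Real.rpow_nonneg (hS y) _) ⟨y, Finset.mem_univ _, ?_⟩
    refine Real.rpow_pos_of_pos (Finset.sum_pos' (fun x _ => Real.rpow_nonneg (hp0 x y) _)
      ⟨x, Finset.mem_univ _, Real.rpow_pos_of_pos hpxy _⟩) _
  have hcoef : ρ * ((1 / (1 + ρ)) / (1 - 1 / (1 + ρ))) = 1 := by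
    have : 1 - 1 / (1 + ρ) = ρ / (1 + ρ) := by field_simp; ring
    rw [this]
    field_simp
  rw [condRenyi, ← mul_assoc, hcoef, one_mul, one_div_one_div,
    Real.rpow_logb two_pos (by norm_num) hpos]

theorem two_rpow_mul_sub_logb {ρ H a : ℝ} (ha : 0 < a) :
    (2 : ℝ) ^ (ρ * (H - Real.logb 2 a)) = (2 : ℝ) ^ (ρ * H) / a ^ ρ := by
  rw [mul_sub, Real.rpow_sub two_pos, mul_comm ρ (Real.logb 2 a),
    Real.rpow_mul two_pos.le (Real.logb 2 a), Real.rpow_logb two_pos (by norm_num) ha]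

theorem sum_inv_le_one_add_log {X : Type*} [Fintype X] {g : X → ℕ}
    (hg : Set.BijOn g Set.univ (Set.Icc 1 (Fintype.card X))) :
    ∑ x, ((g x : ℝ))⁻¹ ≤ 1 + Real.log (Fintype.card X) := by
  have h : ∑ x, ((g x : ℝ))⁻¹ = ∑ i ∈ Finset.Icc 1 (Fintype.card X), ((i : ℝ))⁻¹ := by
    refine Finset.sum_nbij g (fun x _ => ?_) (fun x _ x' _ h => hg.injOn trivial trivial h) ?_
      (fun _ _ => rfl)
    · simpa using hg.mapsTo (Set.mem_univ x)
    · simpa using hg.surjOn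
  rw [h]
  have := harmonic_le_one_add_log (Fintype.card X)
  rw [harmonic_eq_sum_Icc] at this
  simpa using this

theorem exists_blocks {X : Type*} [Fintype X] (A : Finset X) {n : ℕ} (hn : 0 < n) :
    ∃ g : X → ℕ, (∀ x ∈ A, g x < (A.card + n - 1) / n) ∧
      ∀ j, (A.filter fun x => g x = j).card ≤ n := by
  classical
  let r : X → ℕ := fun x => if h : x ∈ A then (A.equivFin ⟨x, h⟩ : ℕ) else 0
  refine ⟨fun x => r x / n, fun x hx => ?_, fun j => ?_⟩
  · have hr : r x < A.card := by simp [r, hx]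
    have h1 : r x / n * n ≤ r x := Nat.div_mul_le_self _ _
    refine (Nat.le_div_iff_mul_le hn).2 ?_
    change (r x / n + 1) * n ≤ _
    rw [Nat.succ_mul]
    omega
  · have hcard : (Finset.Ico (j * n) (j * n + n)).card = n := by simp
    refine (Finset.card_le_card_of_injOn r ?_ ?_).trans_eq hcard
    · intro x hx
      have hx2 : r x / n = j := (Finset.mem_filter.1 hx).2
      have h1 := Nat.div_mul_le_self (r x) n
      have h2 := Nat.lt_div_mul_add (a := r x) hn
      rw [hx2] at h1 h2
      simp only [Finset.coe_Ico, Set.mem_Ico]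
      omega
    · intro x hx x' hx' h
      have hx1 : x ∈ A := (Finset.mem_filter.1 hx).1
      have hx1' : x' ∈ A := (Finset.mem_filter.1 hx').1
      simp only [r, hx1, hx1', dif_pos] at h
      simpa using A.equivFin.injective (Fin.ext h)

theorem exists_latinSquare (K : Type*) [Fintype K] [Nonempty K] :
    ∃ σ : K → K → K, (∀ k, Function.Bijective (σ k)) ∧
      ∀ t, Function.Bijective fun k => σ k t := by
  have : NeZero (Fintype.card K) := ⟨Fintype.card_ne_zero⟩
  have a : K ≃ ZMod (Fintype.card K) := Fintype.equivOfCardEq (by rw [ZMod.card])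
  refine ⟨fun k t => a.symm (a k + a t), fun k => ?_, fun t => ?_⟩
  · exact a.symm.bijective.comp ((Equiv.addLeft (a k)).bijective.comp a.bijective)
  · exact a.symm.bijective.comp ((Equiv.addRight (a t)).bijective.comp a.bijective)

theorem exists_map_card_fiber_le {X T : Type*} [Fintype X] [Fintype T] [DecidableEq T]
    (A : Finset X) (l : X → ℕ) (hl : ∀ x ∈ A, 0 < l x)
    (hT : 2 * ∑ x ∈ A, ((l x : ℝ))⁻¹ + Real.logb 2 (Fintype.card X) + 2 ≤ Fintype.card T) :
    ∃ F : X → T, ∀ x ∈ A, (A.filter fun x' => F x' = F x).card ≤ l x := by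
  classical
  have hlog : 0 ≤ Real.logb 2 (Fintype.card X) := by
    rcases Nat.eq_zero_or_pos (Fintype.card X) with h | h
    · simp [h]
    · exact Real.logb_nonneg one_lt_two (by exact_mod_cast h)
  have hsum : 0 ≤ ∑ x ∈ A, ((l x : ℝ))⁻¹ := Finset.sum_nonneg fun x _ => by positivity
  have hTpos : 0 < Fintype.card T := by
    have : (0 : ℝ) < Fintype.card T := by linarith
    exact_mod_cast this
  have : Nonempty T := Fintype.card_pos_iff.1 hTpos
  let n := Nat.clog 2 (Fintype.card X)
  have hn : (n : ℝ) ≤ Real.logb 2 (Fintype.card X) + 1 := by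
    have h := Nat.ceil_lt_add_one hlog
    have h2 := Real.natCeil_logb_natCast 2 (Fintype.card X)
    push_cast at h2
    rw [h2] at h
    exact h.le
  let i : X → ℕ := fun x => min (Nat.log 2 (l x)) n
  let B : ℕ → Finset X := fun j => A.filter fun x => i x = j
  let N : ℕ → ℕ := fun j => ((B j).card + 2 ^ j - 1) / 2 ^ j
  choose g hgN hg using fun j => exists_blocks (B j) (pow_pos two_pos j)
  let S : Finset (ℕ × ℕ) := (Finset.range (n + 1)).biUnion fun j => {j} ×ˢ Finset.range (N j)
  have hN : ∀ j ∈ Finset.range (n + 1), (N j : ℝ) ≤ 2 * ∑ x ∈ B j, ((l x : ℝ))⁻¹ + 1 := by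
    intro j hj
    have hnonneg : 0 ≤ ∑ x ∈ B j, ((l x : ℝ))⁻¹ := Finset.sum_nonneg fun x _ => by positivity
    rcases (Finset.mem_range_succ_iff.1 hj).lt_or_eq with hjn | rfl
    · have h1 : N j * 2 ^ j ≤ (B j).card + 2 ^ j :=
        (Nat.div_mul_le_self _ _).trans (Nat.sub_le _ _)
      have h2 : (N j : ℝ) * 2 ^ j ≤ (B j).card + 2 ^ j := by exact_mod_cast h1
      have h3 : ((B j).card : ℝ) / 2 ^ j ≤ 2 * ∑ x ∈ B j, ((l x : ℝ))⁻¹ := by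
        rw [Finset.mul_sum, div_eq_mul_inv, ← nsmul_eq_mul]
        refine Finset.card_nsmul_le_sum _ _ _ fun x hx => ?_
        obtain ⟨hxA, hxj⟩ := Finset.mem_filter.1 hx
        have hlogj : Nat.log 2 (l x) = j := by
          simp only [i] at hxj
          omega
        have h4 := Nat.lt_pow_succ_log_self one_lt_two (l x)
        rw [hlogj, pow_succ] at h4
        have h5 : (l x : ℝ) ≤ 2 ^ j * 2 := by exact_mod_cast h4.le
        have h6 : (0 : ℝ) < l x := by exact_mod_cast hl x hxA
        rw [← div_eq_mul_inv, inv_eq_one_div, div_le_div_iff₀ (by positivity) h6]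
        linarith
      have h4 : (N j : ℝ) ≤ (B j).card / 2 ^ j + 1 := by
        rw [div_add_one (by positivity), le_div_iff₀ (by positivity)]
        exact h2
      linarith
    · have h1 : (B n).card ≤ 2 ^ n := (B n).card_le_univ.trans (Nat.le_pow_clog one_lt_two _)
      have h2 : N n < 2 := by
        refine (Nat.div_lt_iff_lt_mul (by positivity)).2 ?_
        have : 0 < 2 ^ n := by positivity
        omega
      have h3 : (N n : ℝ) ≤ 1 := by exact_mod_cast Nat.lt_succ_iff.1 h2
      linarith
  have hcard : S.card ≤ Fintype.card T := by
    have h1 : S.card ≤ ∑ j ∈ Finset.range (n + 1), N j :=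
      Finset.card_biUnion_le.trans_eq (by simp)
    have h2 : ∑ j ∈ Finset.range (n + 1), ∑ x ∈ B j, ((l x : ℝ))⁻¹ = ∑ x ∈ A, ((l x : ℝ))⁻¹ :=
      Finset.sum_fiberwise_of_maps_to
        (fun x _ => Finset.mem_range_succ_iff.2 (min_le_right _ _)) _
    have h3 := Finset.sum_le_sum hN
    rw [Finset.sum_add_distrib, ← Finset.mul_sum, h2] at h3
    simp only [Finset.sum_const, Finset.card_range, nsmul_eq_mul, mul_one] at h3
    have h4 : (S.card : ℝ) ≤ ∑ j ∈ Finset.range (n + 1), (N j : ℝ) := by exact_mod_cast h1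
    push_cast at h3
    have h5 : (S.card : ℝ) ≤ Fintype.card T := by linarith
    exact_mod_cast h5
  obtain ⟨φ⟩ : Nonempty (S ↪ T) :=
    Function.Embedding.nonempty_of_card_le (by rwa [Fintype.card_coe])
  have hS : ∀ x ∈ A, (i x, g (i x) x) ∈ S := by
    intro x hx
    refine Finset.mem_biUnion.2 ⟨i x, Finset.mem_range_succ_iff.2 (min_le_right _ _), ?_⟩
    simpa using hgN (i x) x (Finset.mem_filter.2 ⟨hx, rfl⟩)
  refine ⟨fun x => if h : (i x, g (i x) x) ∈ S then φ ⟨_, h⟩ else Classical.arbitrary T,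
    fun x hx => ?_⟩
  refine (Finset.card_le_card (t := (B (i x)).filter fun x' => g (i x) x' = g (i x) x) ?_).trans
    ((hg (i x) _).trans ?_)
  · intro x' hx'
    obtain ⟨hx'A, h⟩ := Finset.mem_filter.1 hx'
    simp only [hS x hx, hS x' hx'A, dif_pos, EmbeddingLike.apply_eq_iff_eq, Subtype.mk.injEq,
      Prod.mk.injEq] at h
    have h2 := h.2
    rw [h.1] at h2
    exact Finset.mem_filter.2 ⟨Finset.mem_filter.2 ⟨hx'A, h.1⟩, h2⟩
  · exact (Nat.pow_le_pow_right two_pos (min_le_left _ _)).trans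
      (Nat.pow_log_le_self 2 (hl x hx).ne')

theorem natCeil_rpow_lt {ρ ξ : ℝ} (hρ : 0 < ρ) (hξ : 0 < ξ) :
    ((⌈ξ⌉₊ : ℝ)) ^ ρ < 1 + (2 * ξ) ^ ρ := by
  rcases le_or_gt ξ 1 with h | h
  · have h1 : ((⌈ξ⌉₊ : ℝ)) ≤ 1 := by exact_mod_cast Nat.ceil_le.2 (by simpa using h)
    have h2 := Real.rpow_le_one (Nat.cast_nonneg _) h1 hρ.le
    have h3 : 0 < (2 * ξ) ^ ρ := by positivity
    linarith
  · have h1 : ((⌈ξ⌉₊ : ℝ)) ≤ 2 * ξ := by linarith [Nat.ceil_lt_add_one hξ.le]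
    have h2 := Real.rpow_le_rpow (Nat.cast_nonneg _) h1 hρ.le
    linarith

theorem exists_map_sum_fiber_rpow_le {X T : Type*} [Fintype X] [Fintype T] [DecidableEq T]
    {ρ : ℝ} (hρ : 0 < ρ) (q : X → ℝ) (hq : ∀ x, 0 ≤ q x)
    (hT : Real.logb 2 (Fintype.card X) + 2 < Fintype.card T) :
    ∃ F : X → T,
      (∑ x, q x * ((Finset.univ.filter fun x' => 0 < q x' ∧ F x' = F x).card : ℝ) ^ ρ ≤
        ∑ x, q x + (4 / (Fintype.card T - Real.logb 2 (Fintype.card X) - 2)) ^ ρ *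
          (∑ x, q x ^ (1 / (1 + ρ))) ^ (1 + ρ)) ∧
      ((∃ x, 0 < q x) →
        ∑ x, q x * ((Finset.univ.filter fun x' => 0 < q x' ∧ F x' = F x).card : ℝ) ^ ρ <
        ∑ x, q x + (4 / (Fintype.card T - Real.logb 2 (Fintype.card X) - 2)) ^ ρ *
          (∑ x, q x ^ (1 / (1 + ρ))) ^ (1 + ρ)) := by
  classical
  have h1 : (0 : ℝ) < 1 + ρ := by linarith
  set D : ℝ := Fintype.card T - Real.logb 2 (Fintype.card X) - 2 with hD
  have hDpos : 0 < D := by linarith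
  set s := ∑ x, q x ^ (1 / (1 + ρ)) with hs
  have hs0 : 0 ≤ s := Finset.sum_nonneg fun x _ => Real.rpow_nonneg (hq x) _
  have hspos : ∀ x, 0 < q x → 0 < s := fun x hx =>
    Finset.sum_pos' (fun x _ => Real.rpow_nonneg (hq x) _)
      ⟨x, Finset.mem_univ _, Real.rpow_pos_of_pos hx _⟩
  let A : Finset X := Finset.univ.filter fun x => 0 < q x
  let b : X → ℝ := fun x => 2 * s / D * q x ^ (-(1 / (1 + ρ)))
  have hb : ∀ x, 0 < q x → 0 < b x := fun x hx => by
    have := hspos x hx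
    positivity
  have hμ : ∑ x ∈ A, ((⌈b x⌉₊ : ℝ))⁻¹ ≤ D / 2 := by
    rcases hs0.eq_or_lt with h0 | hsp
    · have hA : A = ∅ := Finset.filter_eq_empty_iff.2 fun x _ hx => (hspos x hx).ne h0
      rw [hA, Finset.sum_empty]
      positivity
    · calc ∑ x ∈ A, ((⌈b x⌉₊ : ℝ))⁻¹ ≤ ∑ x ∈ A, D / (2 * s) * q x ^ (1 / (1 + ρ)) := by
            refine Finset.sum_le_sum fun x hx => ?_
            have hx' : 0 < q x := (Finset.mem_filter.1 hx).2
            refine (inv_anti₀ (hb x hx') (Nat.le_ceil _)).trans_eq ?_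
            simp only [b]
            rw [mul_inv, Real.rpow_neg hx'.le, inv_inv, inv_div]
        _ ≤ ∑ x, D / (2 * s) * q x ^ (1 / (1 + ρ)) :=
            Finset.sum_le_univ_sum_of_nonneg fun x => by
              have := hq x
              positivity
        _ = D / 2 := by
            rw [← Finset.mul_sum, ← hs]
            field_simp
  obtain ⟨F, hF⟩ := exists_map_card_fiber_le (T := T) A (fun x => ⌈b x⌉₊)
    (fun x hx => Nat.ceil_pos.2 (hb x (Finset.mem_filter.1 hx).2)) (by linarith)
  have hterm : ∀ x, 0 < q x →
      q x * ((Finset.univ.filter fun x' => 0 < q x' ∧ F x' = F x).card : ℝ) ^ ρ <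
        q x + (4 / D) ^ ρ * s ^ ρ * q x ^ (1 / (1 + ρ)) := by
    intro x hx
    have hsp := hspos x hx
    have hcard : ((Finset.univ.filter fun x' => 0 < q x' ∧ F x' = F x).card : ℝ) ≤ ⌈b x⌉₊ := by
      have := hF x (Finset.mem_filter.2 ⟨Finset.mem_univ _, hx⟩)
      rw [Finset.filter_filter] at this
      exact_mod_cast this
    have hpow := (Real.rpow_le_rpow (Nat.cast_nonneg _) hcard hρ.le).trans_lt
      (natCeil_rpow_lt hρ (hb x hx))
    have hid : q x * (2 * b x) ^ ρ = (4 / D) ^ ρ * s ^ ρ * q x ^ (1 / (1 + ρ)) := by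
      have e1 : 2 * b x = 4 / D * s * q x ^ (-(1 / (1 + ρ))) := by
        simp only [b]
        ring
      rw [e1, Real.mul_rpow (by positivity) (by positivity), Real.mul_rpow (by positivity) hs0,
        ← Real.rpow_mul hx.le, mul_left_comm]
      congr 1
      nth_rewrite 1 [← Real.rpow_one (q x)]
      rw [← Real.rpow_add hx]
      congr 1
      field_simp
      ring
    calc _ < q x * (1 + (2 * b x) ^ ρ) := mul_lt_mul_of_pos_left hpow hx
      _ = _ := by rw [mul_add, mul_one, hid]
  have hterm' : ∀ x,
      q x * ((Finset.univ.filter fun x' => 0 < q x' ∧ F x' = F x).card : ℝ) ^ ρ ≤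
        q x + (4 / D) ^ ρ * s ^ ρ * q x ^ (1 / (1 + ρ)) := by
    intro x
    rcases (hq x).eq_or_lt with h | h
    · rw [← h, zero_mul, Real.zero_rpow (by positivity)]
      simp
    · exact (hterm x h).le
  have htotal : ∑ x, (q x + (4 / D) ^ ρ * s ^ ρ * q x ^ (1 / (1 + ρ))) =
      ∑ x, q x + (4 / D) ^ ρ * s ^ (1 + ρ) := by
    rw [Finset.sum_add_distrib, ← Finset.mul_sum, ← hs]
    rcases hs0.eq_or_lt with h | h
    · rw [← h, Real.zero_rpow h1.ne', mul_zero, mul_zero]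
    · rw [Real.rpow_add h, Real.rpow_one]
      ring
  rw [← htotal]
  exact ⟨F, Finset.sum_le_sum fun x _ => hterm' x, fun ⟨x, hx⟩ =>
    Finset.sum_lt_sum (fun x _ => hterm' x) ⟨x, Finset.mem_univ _, hterm x hx⟩⟩

/-- The deterministic encoder that describes `x` by `F y x = (j, t)` and sends `ι (j, σ k t)`,
where `σ k` is the one-time pad for the key `k`. -/
def padEncoder {𝒳 𝒴 𝒦 𝒨 C : Type*} [DecidableEq 𝒨] (F : 𝒴 → 𝒳 → C × 𝒦) (σ : 𝒦 → 𝒦 → 𝒦)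
    (ι : C × 𝒦 → 𝒨) (x : 𝒳) (y : 𝒴) (k : 𝒦) (m : 𝒨) : ℝ :=
  if m = ι ((F y x).1, σ k (F y x).2) then 1 else 0

theorem sum_padEncoder_mul {𝒳 𝒴 𝒦 𝒨 C : Type*} [Fintype 𝒨] [DecidableEq 𝒨]
    (F : 𝒴 → 𝒳 → C × 𝒦) (σ : 𝒦 → 𝒦 → 𝒦) (ι : C × 𝒦 → 𝒨) (x : 𝒳) (y : 𝒴) (k : 𝒦) (a : ℝ)
    (f : 𝒨 → ℝ) :
    ∑ m, a * padEncoder F σ ι x y k m * f m = a * f (ι ((F y x).1, σ k (F y x).2)) := by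
  simp [padEncoder]

section SecretKey

variable {𝒳 𝒴 𝒦 𝒨 : Type*} [Fintype 𝒳] [Fintype 𝒴] [Fintype 𝒦] [Fintype 𝒨]

theorem sum_comm_secretKey (f : 𝒳 → 𝒴 → 𝒦 → 𝒨 → ℝ) :
    ∑ x, ∑ y, ∑ k, ∑ m, f x y k m = ∑ y, ∑ k, ∑ x, ∑ m, f x y k m := by
  rw [Finset.sum_comm]
  exact Finset.sum_congr rfl fun y _ => Finset.sum_comm

theorem eveAmbSK_le {ρ : ℝ} {p : 𝒳 → 𝒴 → ℝ} (hp0 : ∀ x y, 0 ≤ p x y)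
    {e : 𝒳 → 𝒴 → 𝒦 → 𝒨 → ℝ} (he0 : ∀ x y k m, 0 ≤ e x y k m)
    {G : 𝒴 × 𝒨 → 𝒳 → ℕ} (hG : IsGuess G) :
    eveAmbSK ρ p e ≤ ∑ x : 𝒳, ∑ y : 𝒴, ∑ k : 𝒦, ∑ m : 𝒨,
      p x y * (Fintype.card 𝒦 : ℝ)⁻¹ * e x y k m * (G (y, m) x : ℝ) ^ ρ := by
  refine csInf_le ⟨0, ?_⟩ ⟨G, hG, rfl⟩
  rintro r ⟨G', -, rfl⟩
  refine Finset.sum_nonneg fun x _ => Finset.sum_nonneg fun y _ => Finset.sum_nonneg fun k _ =>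
    Finset.sum_nonneg fun m _ => ?_
  have := hp0 x y
  have := he0 x y k m
  positivity

theorem le_eveAmbSK {ρ : ℝ} {p : 𝒳 → 𝒴 → ℝ} {e : 𝒳 → 𝒴 → 𝒦 → 𝒨 → ℝ} {b : ℝ}
    (h : ∀ G : 𝒴 × 𝒨 → 𝒳 → ℕ, IsGuess G → b ≤ ∑ x : 𝒳, ∑ y : 𝒴, ∑ k : 𝒦, ∑ m : 𝒨,
      p x y * (Fintype.card 𝒦 : ℝ)⁻¹ * e x y k m * (G (y, m) x : ℝ) ^ ρ) :
    b ≤ eveAmbSK ρ p e := by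
  obtain ⟨g, hg, -⟩ := exists_bijOn_le_card_filter fun _ : 𝒳 => (0 : ℕ)
  refine le_csInf ⟨_, fun _ => g, fun _ => hg, rfl⟩ ?_
  rintro r ⟨G, hG, rfl⟩
  exact h G hG

theorem sum_joint_mul_const [Nonempty 𝒦] {p : 𝒳 → 𝒴 → ℝ} {e : 𝒳 → 𝒴 → 𝒦 → 𝒨 → ℝ}
    (he1 : ∀ x y k, ∑ m, e x y k m = 1) (a : 𝒳 → 𝒴 → ℝ) :
    ∑ x, ∑ y, ∑ k, ∑ m, p x y * (Fintype.card 𝒦 : ℝ)⁻¹ * e x y k m * a x y =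
      ∑ x, ∑ y, p x y * a x y := by
  refine Finset.sum_congr rfl fun x _ => Finset.sum_congr rfl fun y _ => ?_
  simp only [← Finset.sum_mul, ← Finset.mul_sum, he1, mul_one, Finset.sum_const, Finset.card_univ,
    nsmul_eq_mul]
  field_simp

theorem one_le_bobListAmbSK [Nonempty 𝒦] {ρ : ℝ} (hρ : 0 < ρ) {p : 𝒳 → 𝒴 → ℝ}
    (hp0 : ∀ x y, 0 ≤ p x y) (hp1 : ∑ x : 𝒳, ∑ y : 𝒴, p x y = 1)
    {e : 𝒳 → 𝒴 → 𝒦 → 𝒨 → ℝ} (he0 : ∀ x y k m, 0 ≤ e x y k m)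
    (he1 : ∀ x y k, ∑ m, e x y k m = 1) : 1 ≤ bobListAmbSK ρ p e := by
  have h := sum_joint_mul_const (p := p) he1 fun _ _ => (1 : ℝ)
  simp only [mul_one, hp1] at h
  rw [← h, bobListAmbSK]
  refine Finset.sum_le_sum fun x _ => Finset.sum_le_sum fun y _ => Finset.sum_le_sum fun k _ =>
    Finset.sum_le_sum fun m _ => ?_
  have hpe := mul_nonneg (hp0 x y) (he0 x y k m)
  have hK : (0 : ℝ) ≤ (Fintype.card 𝒦 : ℝ)⁻¹ := by positivity
  rcases hpe.eq_or_lt with h0 | h0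
  · rw [mul_right_comm, ← h0]
    simp
  · refine le_mul_of_one_le_right (by rw [mul_right_comm]; positivity)
      (Real.one_le_rpow ?_ hρ.le)
    exact_mod_cast Finset.card_pos.2 ⟨x, by simpa using h0⟩

theorem rpow_sum_le_sum_list_mul {ρ : ℝ} (hρ : 0 < ρ) {q : 𝒳 → ℝ} (hq : ∀ x, 0 ≤ q x)
    {e : 𝒳 → 𝒨 → ℝ} (he0 : ∀ x m, 0 ≤ e x m) (he1 : ∀ x, ∑ m, e x m = 1) :
    (∑ x, q x ^ (1 / (1 + ρ))) ^ (1 + ρ) ≤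
      (∑ x, ∑ m, q x * e x m *
        ((Finset.univ.filter fun x' => 0 < q x' * e x' m).card : ℝ) ^ ρ) *
          (Fintype.card 𝒨 : ℝ) ^ ρ := by
  classical
  have h1 : (0 : ℝ) < 1 + ρ := by linarith
  let n : 𝒨 → ℕ := fun m => (Finset.univ.filter fun x' => 0 < q x' * e x' m).card
  let s : Finset (𝒳 × 𝒨) := Finset.univ.filter fun z => 0 < q z.1 * e z.1 z.2
  have hB : ∑ z ∈ s, ((n z.2 : ℝ))⁻¹ ≤ Fintype.card 𝒨 := by
    rw [Finset.sum_filter, Fintype.sum_prod_type_right, ← Finset.card_univ, Finset.cast_card]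
    refine Finset.sum_le_sum fun m _ => ?_
    rw [← Finset.sum_filter]
    change ∑ x ∈ Finset.univ.filter fun x => 0 < q x * e x m, ((n m : ℝ))⁻¹ ≤ 1
    rw [Finset.sum_const, nsmul_eq_mul]
    exact mul_inv_le_one
  have hH := rpow_sum_le_sum_mul_rpow hρ s (fun z => q z.1 * e z.1 z.2) (fun z => (n z.2 : ℝ))
    (fun z hz => (Finset.mem_filter.1 hz).2.le)
    (fun z hz => by
      have := (Finset.mem_filter.1 hz).2
      exact_mod_cast Finset.card_pos.2 ⟨z.1, by simpa using this⟩) hB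
  have hzero : ∀ z ∈ (Finset.univ : Finset (𝒳 × 𝒨)), z ∉ s → q z.1 * e z.1 z.2 = 0 := by
    intro z _ hz
    have : ¬ 0 < q z.1 * e z.1 z.2 := fun h => hz (Finset.mem_filter.2 ⟨Finset.mem_univ _, h⟩)
    exact le_antisymm (not_lt.1 this) (mul_nonneg (hq _) (he0 _ _))
  rw [Finset.sum_subset (Finset.subset_univ s) fun z h h' => by
      rw [hzero z h h', Real.zero_rpow (by positivity)],
    Finset.sum_subset (Finset.subset_univ s) fun z h h' => by rw [hzero z h h', zero_mul],
    Fintype.sum_prod_type, Fintype.sum_prod_type] at hH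
  refine le_trans (Real.rpow_le_rpow (Finset.sum_nonneg fun x _ => Real.rpow_nonneg (hq x) _)
    (Finset.sum_le_sum fun x _ => ?_) h1.le) hH
  have he_le : ∀ m, e x m ≤ 1 := fun m => by
    rw [← he1 x]
    exact Finset.single_le_sum (fun m _ => he0 x m) (Finset.mem_univ m)
  calc q x ^ (1 / (1 + ρ)) = ∑ m, q x ^ (1 / (1 + ρ)) * e x m := by
        rw [← Finset.mul_sum, he1, mul_one]
    _ ≤ ∑ m, (q x * e x m) ^ (1 / (1 + ρ)) := by
        refine Finset.sum_le_sum fun m _ => ?_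
        rw [Real.mul_rpow (hq x) (he0 x m)]
        refine mul_le_mul_of_nonneg_left (Real.self_le_rpow_of_le_one (he0 x m) (he_le m) ?_)
          (Real.rpow_nonneg (hq x) _)
        rw [div_le_one h1]
        linarith

theorem le_bobListAmbSK [Nonempty 𝒦] [Nonempty 𝒨] {ρ : ℝ} (hρ : 0 < ρ) {p : 𝒳 → 𝒴 → ℝ}
    (hp0 : ∀ x y, 0 ≤ p x y) (hp1 : ∑ x : 𝒳, ∑ y : 𝒴, p x y = 1)
    {e : 𝒳 → 𝒴 → 𝒦 → 𝒨 → ℝ} (he0 : ∀ x y k m, 0 ≤ e x y k m)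
    (he1 : ∀ x y k, ∑ m, e x y k m = 1) :
    (2 : ℝ) ^ (ρ * (condRenyi ρ p - Real.logb 2 (Fintype.card 𝒨 : ℝ))) ≤
      bobListAmbSK ρ p e := by
  have hM : (0 : ℝ) < Fintype.card 𝒨 := by exact_mod_cast Fintype.card_pos
  have hK : (0 : ℝ) < Fintype.card 𝒦 := by exact_mod_cast Fintype.card_pos
  rw [two_rpow_mul_sub_logb hM, two_rpow_mul_condRenyi hρ p hp0 hp1, bobListAmbSK,
    sum_comm_secretKey, Finset.sum_div]
  refine Finset.sum_le_sum fun y _ => ?_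
  have hk : ∀ k ∈ (Finset.univ : Finset 𝒦),
      (Fintype.card 𝒦 : ℝ)⁻¹ *
        ((∑ x : 𝒳, p x y ^ (1 / (1 + ρ))) ^ (1 + ρ) / (Fintype.card 𝒨 : ℝ) ^ ρ) ≤
      ∑ x, ∑ m, p x y * (Fintype.card 𝒦 : ℝ)⁻¹ * e x y k m *
        ((Finset.univ.filter fun x' : 𝒳 => 0 < p x' y * e x' y k m).card : ℝ) ^ ρ := by
    intro k _
    have h := rpow_sum_le_sum_list_mul hρ (fun x => hp0 x y) (fun x m => he0 x y k m)
      (fun x => he1 x y k)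
    rw [← div_le_iff₀ (by positivity)] at h
    refine (mul_le_mul_of_nonneg_left h (by positivity)).trans_eq ?_
    simp only [Finset.mul_sum]
    exact Finset.sum_congr rfl fun x _ => Finset.sum_congr rfl fun m _ => by ring
  refine le_of_eq_of_le ?_ (Finset.sum_le_sum hk)
  rw [Finset.sum_const, Finset.card_univ, nsmul_eq_mul, mul_inv_cancel_left₀ hK.ne']

theorem eveAmbSK_le_card_rpow_mul_bobListAmbSK [Nonempty 𝒦] {ρ : ℝ} (hρ : 0 < ρ)
    {p : 𝒳 → 𝒴 → ℝ} (hp0 : ∀ x y, 0 ≤ p x y)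
    {e : 𝒳 → 𝒴 → 𝒦 → 𝒨 → ℝ} (he0 : ∀ x y k m, 0 ≤ e x y k m) :
    eveAmbSK ρ p e ≤ (Fintype.card 𝒦 : ℝ) ^ ρ * bobListAmbSK ρ p e := by
  choose g hg hle using fun z : 𝒴 × 𝒨 => exists_bijOn_le_card_mul_card fun k : 𝒦 =>
    Finset.univ.filter fun x' : 𝒳 => 0 < p x' z.1 * e x' z.1 k z.2
  refine (eveAmbSK_le hp0 he0 (G := g) hg).trans ?_
  rw [bobListAmbSK]
  simp only [Finset.mul_sum]
  refine Finset.sum_le_sum fun x _ => Finset.sum_le_sum fun y _ => Finset.sum_le_sum fun k _ =>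
    Finset.sum_le_sum fun m _ => ?_
  rw [mul_left_comm]
  have hpe := mul_nonneg (hp0 x y) (he0 x y k m)
  rcases hpe.eq_or_lt with h0 | h0
  · rw [mul_right_comm (p x y), ← h0]
    simp
  · refine mul_le_mul_of_nonneg_left ?_ (by rw [mul_right_comm (p x y)]; positivity)
    rw [← Real.mul_rpow (by positivity) (by positivity)]
    refine Real.rpow_le_rpow (by positivity) ?_ hρ.le
    exact_mod_cast hle (y, m) k x (by simpa using h0)

theorem exists_bijOn_sum_mul_rpow_le {X : Type*} [Fintype X] {ρ : ℝ} (hρ : 0 < ρ) {q : X → ℝ}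
    (hq : ∀ x, 0 ≤ q x) :
    ∃ g : X → ℕ, Set.BijOn g Set.univ (Set.Icc 1 (Fintype.card X)) ∧
      ∑ x, q x * (g x : ℝ) ^ ρ ≤ (∑ x, q x ^ (1 / (1 + ρ))) ^ (1 + ρ) := by
  have h1 : (0 : ℝ) < 1 + ρ := by linarith
  obtain ⟨g, hg, hle⟩ := exists_bijOn_le_card_filter fun x => -q x
  refine ⟨g, hg, ?_⟩
  set s := ∑ x, q x ^ (1 / (1 + ρ)) with hs
  have hs0 : 0 ≤ s := Finset.sum_nonneg fun x _ => Real.rpow_nonneg (hq x) _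
  have hterm : ∀ x, q x * (g x : ℝ) ^ ρ ≤ s ^ ρ * q x ^ (1 / (1 + ρ)) := by
    intro x
    rcases (hq x).eq_or_lt with h | h
    · rw [← h, zero_mul, Real.zero_rpow (by positivity), mul_zero]
    · have hgx : (g x : ℝ) * q x ^ (1 / (1 + ρ)) ≤ s := by
        calc (g x : ℝ) * q x ^ (1 / (1 + ρ))
            ≤ (Finset.univ.filter fun x' => -q x' ≤ -q x).card * q x ^ (1 / (1 + ρ)) := by
              gcongr
              exact hle x
          _ ≤ ∑ x' ∈ Finset.univ.filter fun x' => -q x' ≤ -q x, q x' ^ (1 / (1 + ρ)) := by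
              rw [← nsmul_eq_mul]
              refine Finset.card_nsmul_le_sum _ _ _ fun x' hx' => ?_
              have := (Finset.mem_filter.1 hx').2
              exact Real.rpow_le_rpow h.le (by linarith) (by positivity)
          _ ≤ s := Finset.sum_le_univ_sum_of_nonneg fun x' => Real.rpow_nonneg (hq x') _
      have hpow := Real.rpow_le_rpow (by positivity) hgx hρ.le
      have hsplit : q x = q x ^ (1 / (1 + ρ)) * (q x ^ (1 / (1 + ρ))) ^ ρ := by
        rw [← Real.rpow_mul h.le, ← Real.rpow_add h]
        nth_rewrite 1 [← Real.rpow_one (q x)]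
        congr 1
        field_simp
      calc q x * (g x : ℝ) ^ ρ
          = q x ^ (1 / (1 + ρ)) * ((g x : ℝ) * q x ^ (1 / (1 + ρ))) ^ ρ := by
            rw [Real.mul_rpow (by positivity) (by positivity)]
            nth_rewrite 1 [hsplit]
            ring
        _ ≤ q x ^ (1 / (1 + ρ)) * s ^ ρ := by gcongr
        _ = s ^ ρ * q x ^ (1 / (1 + ρ)) := mul_comm _ _
  refine (Finset.sum_le_sum fun x _ => hterm x).trans_eq ?_
  rw [← Finset.mul_sum, ← hs]
  rcases hs0.eq_or_lt with h | h
  · rw [← h, Real.zero_rpow h1.ne', mul_zero]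
  · rw [Real.rpow_add h, Real.rpow_one, mul_comm]

theorem eveAmbSK_le_two_rpow [Nonempty 𝒦] {ρ : ℝ} (hρ : 0 < ρ) {p : 𝒳 → 𝒴 → ℝ}
    (hp0 : ∀ x y, 0 ≤ p x y) (hp1 : ∑ x : 𝒳, ∑ y : 𝒴, p x y = 1)
    {e : 𝒳 → 𝒴 → 𝒦 → 𝒨 → ℝ} (he0 : ∀ x y k m, 0 ≤ e x y k m)
    (he1 : ∀ x y k, ∑ m, e x y k m = 1) :
    eveAmbSK ρ p e ≤ (2 : ℝ) ^ (ρ * condRenyi ρ p) := by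
  choose g hg hle using fun y => exists_bijOn_sum_mul_rpow_le hρ fun x => hp0 x y
  refine (eveAmbSK_le hp0 he0 (G := fun z => g z.1) fun z => hg z.1).trans ?_
  rw [two_rpow_mul_condRenyi hρ p hp0 hp1,
    sum_joint_mul_const he1 fun x y => ((g y x : ℝ)) ^ ρ, Finset.sum_comm]
  exact Finset.sum_le_sum fun y _ => hle y

theorem bobListAmbSK_padEncoder [Nonempty 𝒦] {C : Type*} [DecidableEq C] [DecidableEq 𝒦]
    [DecidableEq 𝒨] {ρ : ℝ} {p : 𝒳 → 𝒴 → ℝ} (F : 𝒴 → 𝒳 → C × 𝒦) {σ : 𝒦 → 𝒦 → 𝒦}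
    (hσ : ∀ k, Function.Injective (σ k)) {ι : C × 𝒦 → 𝒨} (hι : Function.Injective ι) :
    bobListAmbSK ρ p (padEncoder F σ ι) = ∑ y, ∑ x, p x y *
      ((Finset.univ.filter fun x' => 0 < p x' y ∧ F y x' = F y x).card : ℝ) ^ ρ := by
  rw [bobListAmbSK, Finset.sum_comm]
  refine Finset.sum_congr rfl fun y _ => Finset.sum_congr rfl fun x _ => ?_
  have hlist : ∀ k, (Finset.univ.filter fun x' : 𝒳 =>
      0 < p x' y * padEncoder F σ ι x' y k (ι ((F y x).1, σ k (F y x).2))) =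
      Finset.univ.filter fun x' => 0 < p x' y ∧ F y x' = F y x := by
    intro k
    ext x'
    simp only [padEncoder, hι.eq_iff, Prod.mk.injEq, (hσ k).eq_iff, ← Prod.ext_iff, mul_ite,
      mul_one, mul_zero, Finset.mem_filter, Finset.mem_univ, true_and]
    by_cases h : F y x = F y x' <;> simp [h, eq_comm]
  simp only [sum_padEncoder_mul F σ ι x y _ _ fun m => _, hlist]
  rw [Finset.sum_const, Finset.card_univ, nsmul_eq_mul]
  field_simp

theorem le_eveAmbSK_padEncoder [Nonempty 𝒦] [Nonempty 𝒳] {C : Type*} [Fintype C] [Nonempty C]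
    [DecidableEq 𝒨] {ρ : ℝ} (hρ : 0 < ρ) {p : 𝒳 → 𝒴 → ℝ}
    (hp0 : ∀ x y, 0 ≤ p x y) (hp1 : ∑ x : 𝒳, ∑ y : 𝒴, p x y = 1)
    (F : 𝒴 → 𝒳 → C × 𝒦) {σ : 𝒦 → 𝒦 → 𝒦} (hσ : ∀ t, Function.Bijective fun k => σ k t)
    (ι : C × 𝒦 → 𝒨) :
    (1 + Real.log (Fintype.card 𝒳)) ^ (-ρ) *
      (2 : ℝ) ^ (ρ * (condRenyi ρ p - Real.logb 2 (Fintype.card C))) ≤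
        eveAmbSK ρ p (padEncoder F σ ι) := by
  classical
  have hC : (0 : ℝ) < Fintype.card C := by exact_mod_cast Fintype.card_pos
  have hK : (0 : ℝ) < Fintype.card 𝒦 := by exact_mod_cast Fintype.card_pos
  have hX : (1 : ℝ) ≤ Fintype.card 𝒳 := by exact_mod_cast Nat.succ_le_of_lt Fintype.card_pos
  have hlog : 0 < 1 + Real.log (Fintype.card 𝒳) := by linarith [Real.log_nonneg hX]
  refine le_eveAmbSK fun G hG => ?_
  rw [two_rpow_mul_sub_logb hC, two_rpow_mul_condRenyi hρ p hp0 hp1, Real.rpow_neg hlog.le,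
    inv_mul_eq_div, div_div, ← Real.mul_rpow hC.le hlog.le, Finset.sum_comm, Finset.sum_div]
  refine Finset.sum_le_sum fun y _ => ?_
  have hpad : ∀ x, ∑ k, ∑ m, p x y * (Fintype.card 𝒦 : ℝ)⁻¹ * padEncoder F σ ι x y k m *
      (G (y, m) x : ℝ) ^ ρ =
        ∑ t, p x y * (Fintype.card 𝒦 : ℝ)⁻¹ * (G (y, ι ((F y x).1, t)) x : ℝ) ^ ρ := by
    intro x
    simp only [sum_padEncoder_mul F σ ι x y _ _ fun m => (G (y, m) x : ℝ) ^ ρ]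
    exact (hσ (F y x).2).sum_comp fun t =>
      p x y * (Fintype.card 𝒦 : ℝ)⁻¹ * (G (y, ι ((F y x).1, t)) x : ℝ) ^ ρ
  rw [Finset.sum_congr rfl fun x _ => hpad x, Finset.sum_comm]
  have hGpos : ∀ z x, 0 < (G z x : ℝ) := fun z x => by
    exact_mod_cast ((hG z).mapsTo (Set.mem_univ x)).1
  have ht : ∀ t ∈ (Finset.univ : Finset 𝒦),
      (Fintype.card 𝒦 : ℝ)⁻¹ * ((∑ x : 𝒳, p x y ^ (1 / (1 + ρ))) ^ (1 + ρ) /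
        (Fintype.card C * (1 + Real.log (Fintype.card 𝒳))) ^ ρ) ≤
      ∑ x, p x y * (Fintype.card 𝒦 : ℝ)⁻¹ * (G (y, ι ((F y x).1, t)) x : ℝ) ^ ρ := by
    intro t _
    have hB : ∑ x, ((G (y, ι ((F y x).1, t)) x : ℝ))⁻¹ ≤
        Fintype.card C * (1 + Real.log (Fintype.card 𝒳)) := by
      calc ∑ x, ((G (y, ι ((F y x).1, t)) x : ℝ))⁻¹
          ≤ ∑ x, ∑ j : C, ((G (y, ι (j, t)) x : ℝ))⁻¹ :=
            Finset.sum_le_sum fun x _ => Finset.single_le_sum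
              (f := fun j : C => ((G (y, ι (j, t)) x : ℝ))⁻¹)
              (fun j _ => (inv_pos.2 (hGpos _ _)).le) (Finset.mem_univ _)
        _ = ∑ j : C, ∑ x, ((G (y, ι (j, t)) x : ℝ))⁻¹ := Finset.sum_comm
        _ ≤ ∑ _j : C, (1 + Real.log (Fintype.card 𝒳)) :=
            Finset.sum_le_sum fun j _ => sum_inv_le_one_add_log (hG _)
        _ = _ := by rw [Finset.sum_const, Finset.card_univ, nsmul_eq_mul]
    have h := rpow_sum_le_sum_mul_rpow hρ Finset.univ (fun x => p x y)
      (fun x => (G (y, ι ((F y x).1, t)) x : ℝ)) (fun x _ => hp0 x y) (fun x _ => hGpos _ _) hB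
    rw [← div_le_iff₀ (by positivity)] at h
    refine (mul_le_mul_of_nonneg_left h (by positivity)).trans_eq ?_
    rw [Finset.mul_sum]
    exact Finset.sum_congr rfl fun x _ => by ring
  refine le_of_eq_of_le ?_ (Finset.sum_le_sum ht)
  rw [Finset.sum_const, Finset.card_univ, nsmul_eq_mul, mul_inv_cancel_left₀ hK.ne']

end SecretKey

/-- Theorem 13 (secret key, list version). -/
theorem secret_key_list
    {𝒳 𝒴 𝒦 𝒨 : Type*} [Fintype 𝒳] [Fintype 𝒴] [Fintype 𝒦] [Fintype 𝒨] [Nonempty 𝒦]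
    (ρ : ℝ) (hρ : 0 < ρ)
    (p : 𝒳 → 𝒴 → ℝ) (hp0 : ∀ x y, 0 ≤ p x y) (hp1 : ∑ x : 𝒳, ∑ y : 𝒴, p x y = 1)
    (hKM : Fintype.card 𝒦 ≤ Fintype.card 𝒨)
    (hM : Real.logb 2 (Fintype.card 𝒳) + 2 <
      (((Fintype.card 𝒨 / Fintype.card 𝒦) * Fintype.card 𝒦 : ℕ) : ℝ)) :
    (∀ c : ℕ, 0 < c → c * Fintype.card 𝒦 ≤ Fintype.card 𝒨 →
      Real.logb 2 (Fintype.card 𝒳) + 2 < ((c * Fintype.card 𝒦 : ℕ) : ℝ) →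
      ∃ e : 𝒳 → 𝒴 → 𝒦 → 𝒨 → ℝ,
        (∀ x y k m, 0 ≤ e x y k m) ∧ (∀ x y k, ∑ m : 𝒨, e x y k m = 1) ∧
        (∀ x y k m, e x y k m = 0 ∨ e x y k m = 1) ∧
        bobListAmbSK ρ p e <
          1 + (2 : ℝ) ^ (ρ * (condRenyi ρ p -
            Real.logb 2 (((c * Fintype.card 𝒦 : ℕ) : ℝ) -
              Real.logb 2 (Fintype.card 𝒳) - 2) + 2)) ∧
        (1 + Real.log (Fintype.card 𝒳)) ^ (-ρ) *
            (2 : ℝ) ^ (ρ * (condRenyi ρ p - Real.logb 2 (c : ℝ))) ≤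
          eveAmbSK ρ p e) ∧
    (∀ e : 𝒳 → 𝒴 → 𝒦 → 𝒨 → ℝ,
      (∀ x y k m, 0 ≤ e x y k m) → (∀ x y k, ∑ m : 𝒨, e x y k m = 1) →
      bobListAmbSK ρ p e ≥
        max ((2 : ℝ) ^ (ρ * (condRenyi ρ p - Real.logb 2 (Fintype.card 𝒨 : ℝ)))) 1 ∧
      eveAmbSK ρ p e ≤
        min ((Fintype.card 𝒦 : ℝ) ^ ρ * bobListAmbSK ρ p e)
          ((2 : ℝ) ^ (ρ * condRenyi ρ p))) := by
  classical
  have hcardK : 0 < Fintype.card 𝒦 := Fintype.card_pos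
  have : Nonempty 𝒨 := Fintype.card_pos_iff.1 (hcardK.trans_le hKM)
  obtain ⟨x₀, -, hx₀⟩ := Finset.exists_ne_zero_of_sum_ne_zero (hp1.trans_ne one_ne_zero)
  obtain ⟨y₀, -, hy₀⟩ := Finset.exists_ne_zero_of_sum_ne_zero hx₀
  have : Nonempty 𝒳 := ⟨x₀⟩
  constructor
  · intro c hc hcM hcX
    have : Nonempty (Fin c) := ⟨⟨0, hc⟩⟩
    have hcard : Fintype.card (Fin c × 𝒦) = c * Fintype.card 𝒦 := by simp
    obtain ⟨ι⟩ : Nonempty (Fin c × 𝒦 ↪ 𝒨) :=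
      Function.Embedding.nonempty_of_card_le (by rwa [hcard])
    obtain ⟨σ, hσ, hσ'⟩ := exists_latinSquare 𝒦
    choose F hF hF' using fun y => exists_map_sum_fiber_rpow_le (T := Fin c × 𝒦) hρ
      (fun x => p x y) (fun x => hp0 x y) (by rwa [hcard])
    rw [hcard] at hF hF'
    refine ⟨padEncoder F σ ι, fun x y k m => ?_, fun x y k => ?_, fun x y k m => ?_, ?_, ?_⟩
    · unfold padEncoder
      split_ifs <;> norm_num
    · simp [padEncoder]
    · unfold padEncoder
      split_ifs <;> simp
    · rw [bobListAmbSK_padEncoder F (fun k => (hσ k).injective) ι.injective]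
      refine (Finset.sum_lt_sum (fun y _ => hF y)
        ⟨y₀, Finset.mem_univ _, hF' y₀ ⟨x₀, (hp0 _ _).lt_of_ne' hy₀⟩⟩).trans_eq ?_
      set D : ℝ := ((c * Fintype.card 𝒦 : ℕ) : ℝ) - Real.logb 2 (Fintype.card 𝒳) - 2 with hD
      have hDpos : 0 < D := by linarith
      have h4 : (4 : ℝ) = 2 ^ (2 : ℝ) := by norm_num
      rw [Finset.sum_add_distrib, Finset.sum_comm, hp1, ← Finset.mul_sum,
        ← two_rpow_mul_condRenyi hρ p hp0 hp1, mul_add, Real.rpow_add two_pos,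
        two_rpow_mul_sub_logb hDpos, Real.div_rpow (by norm_num) hDpos.le, h4,
        ← Real.rpow_mul two_pos.le, mul_comm 2 ρ]
      ring
    · have h := le_eveAmbSK_padEncoder hρ hp0 hp1 F hσ' ι
      rwa [Fintype.card_fin] at h
  · intro e he0 he1
    exact ⟨max_le (le_bobListAmbSK hρ hp0 hp1 he0 he1) (one_le_bobListAmbSK hρ hp0 hp1 he0 he1),
      le_min (eveAmbSK_le_card_rpow_mul_bobListAmbSK hρ hp0 he0)
        (eveAmbSK_le_two_rpow hρ hp0 hp1 he0 he1)⟩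
end
end
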